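/- Suppose that for every regular 𝓓-class D of IG(E) that is not maximal, the maximal subgroup of D is finite. Then IG(E) has a decidable word problem: the set {(u, v) ∈ E⁺ × E⁺ : ū = v̄ in IG(E)} is a computable (decidable) set. -/

import Mathlib

section Green

variable {T : Type*} [Semigroup T]

/-- Green's relation 𝓡. -/
def GreenR (a b : T) : Prop := a = b ∨ ∃ x y : T, a * x = b ∧ b * y = a

/-- Green's relation 𝓛. -/
def GreenL (a b : T) : Prop := a = b ∨ ∃ x y : T, x * a = b ∧ y * b = a

/-- Green's relation 𝓓 = 𝓡 ∘ 𝓛. -/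
def GreenD (a b : T) : Prop := ∃ c : T, GreenR a c ∧ GreenL c b

/-- An element is regular if `a = a * b * a` for some `b`. -/
def IsRegularElem (a : T) : Prop := ∃ b : T, a * b * a = a

/-- The principal two-sided ideal `T¹ a T¹`. -/
def principalIdeal (a : T) : Set T :=
  {x | x = a ∨ (∃ u, u * a = x) ∨ (∃ v, a * v = x) ∨ ∃ u v, u * a * v = x}

/-- Green's relation 𝓙. -/
def GreenJ (a b : T) : Prop := principalIdeal a = principalIdeal b

/-- The 𝓙-preorder. -/
def JleRel (a b : T) : Prop := principalIdeal a ⊆ principalIdeal b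

/-- Strict 𝓙-order. -/
def JltRel (a b : T) : Prop := JleRel a b ∧ ¬ JleRel b a

/-- `u` is a (two-sided) identity element. -/
def IsIdentityElem (u : T) : Prop := ∀ x : T, u * x = x ∧ x * u = x

/-- The relation 𝓡̃. -/
def RTilde (a b : T) : Prop := ∀ ε : T, ε * ε = ε → (ε * a = a ↔ ε * b = b)

/-- The relation 𝓛̃. -/
def LTilde (a b : T) : Prop := ∀ ε : T, ε * ε = ε → (a * ε = a ↔ b * ε = b)

/-- `blockProd p i k = p i * p (i+1) * ⋯ * p (i+k)`. -/
def blockProd (p : ℕ → T) (i : ℕ) : ℕ → T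
  | 0 => p i
  | k + 1 => blockProd p i k * p (i + (k + 1))

/-- Multiply `x` by optional (possibly empty) words on both sides. -/
def withCtx (u : Option T) (x : T) (v : Option T) : T :=
  match u, v with
  | none, none => x
  | some u', none => u' * x
  | none, some v' => x * v'
  | some u', some v' => u' * x * v'

/-- Multiply by an optional word on the left. -/
def leftCtx (u : Option T) (x : T) : T := match u with | none => x | some u' => u' * x

/-- Multiply by an optional word on the right. -/
def rightCtx (x : T) (v : Option T) : T := match v with | none => x | some v' => x * v'

end Green

section IGdef

/-- The set of idempotents of `S`. -/
abbrev IdemE (S : Type*) [Semigroup S] : Type _ := {x : S // x * x = x}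

variable {S : Type*} [Semigroup S]

/-- `e, f` form a basic pair if `{e,f} ∩ {ef,fe} ≠ ∅`. -/
def BasicPair (e f : IdemE S) : Prop :=
  (e : S) * f = e ∨ (e : S) * f = f ∨ (f : S) * e = e ∨ (f : S) * e = f

/-- The defining relations of IG(E): `ef = g` whenever `e, f` is a basic pair with
product `g` in `S`. -/
def igRelBase (u v : FreeSemigroup (IdemE S)) : Prop :=
  ∃ e f g : IdemE S, BasicPair e f ∧ (g : S) = (e : S) * (f : S) ∧
    u = FreeSemigroup.of e * FreeSemigroup.of f ∧ v = FreeSemigroup.of g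

/-- The congruence on the free semigroup `E⁺` generated by the defining relations. -/
def igCon (S : Type*) [Semigroup S] : Con (FreeSemigroup (IdemE S)) :=
  conGen (fun u v => igRelBase u v)

/-- The free idempotent generated semigroup IG(E). -/
abbrev IG (S : Type*) [Semigroup S] := (igCon S).Quotient

/-- `w̄`, the image of a word `w ∈ E⁺` in IG(E). -/
def igBar (w : FreeSemigroup (IdemE S)) : IG S := (w : (igCon S).Quotient)

/-- The list of letters of a word. -/
def wordList (w : FreeSemigroup (IdemE S)) : List (IdemE S) := w.head :: w.tail

/-- The length of a word. -/
def wlen (w : FreeSemigroup (IdemE S)) : ℕ := (wordList w).length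

/-- Length of an optional word. -/
def olen (u : Option (FreeSemigroup (IdemE S))) : ℕ :=
  match u with | none => 0 | some u' => wlen u'

/-- `p 1, …, p m` is an r-factorisation of `w`: each factor represents a regular
element of IG(E). -/
def IsRFact (w : FreeSemigroup (IdemE S)) (m : ℕ) (p : ℕ → FreeSemigroup (IdemE S)) : Prop :=
  1 ≤ m ∧ blockProd p 1 (m - 1) = w ∧ ∀ i, 1 ≤ i → i ≤ m → IsRegularElem (igBar (p i))

/-- A minimal r-factorisation: no product of two or more consecutive factors is regular. -/
def IsMinRFact (w : FreeSemigroup (IdemE S)) (m : ℕ) (p : ℕ → FreeSemigroup (IdemE S)) : Prop :=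
  IsRFact w m p ∧
    ∀ i j, 1 ≤ i → i < j → j ≤ m → ¬ IsRegularElem (igBar (blockProd p i (j - i)))

/-- The relation ≈ on m-tuples of words. -/
def TupleApprox (m : ℕ) (p q : ℕ → FreeSemigroup (IdemE S)) : Prop :=
  (∃ i, 1 ≤ i ∧ i ≤ m ∧ igBar (p i) = igBar (q i) ∧
    ∀ j, 1 ≤ j → j ≤ m → j ≠ i → p j = q j) ∨
  (∃ i, ∃ e : IdemE S, 1 ≤ i ∧ i < m ∧
    igBar (p i) = igBar (q i * FreeSemigroup.of e) ∧
    igBar (q (i + 1)) = igBar (FreeSemigroup.of e * p (i + 1)) ∧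
    ∀ j, 1 ≤ j → j ≤ m → j ≠ i → j ≠ i + 1 → p j = q j) ∨
  (∃ i, ∃ e : IdemE S, 1 ≤ i ∧ i < m ∧
    igBar (q i) = igBar (p i * FreeSemigroup.of e) ∧
    igBar (p (i + 1)) = igBar (FreeSemigroup.of e * q (i + 1)) ∧
    ∀ j, 1 ≤ j → j ≤ m → j ≠ i → j ≠ i + 1 → p j = q j)

/-- The relation ∼: the transitive closure of ≈. -/
def TupleSim (m : ℕ) (p q : ℕ → FreeSemigroup (IdemE S)) : Prop :=
  Relation.TransGen (TupleApprox m) p q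

/-- One application of a defining relation of IG(E) inside a word. -/
def RewriteStep (w w' : FreeSemigroup (IdemE S)) : Prop :=
  ∃ (u v : Option (FreeSemigroup (IdemE S))) (x y : FreeSemigroup (IdemE S)),
    (igRelBase x y ∨ igRelBase y x) ∧ w = withCtx u x v ∧ w' = withCtx u y v

/-- `e` is a seed of `w` at (1-based) position `k`. -/
def SeedAt (w : FreeSemigroup (IdemE S)) (e : IdemE S) (k : ℕ) : Prop :=
  ∃ u v : Option (FreeSemigroup (IdemE S)),
    w = withCtx u (FreeSemigroup.of e) v ∧ k = olen u + 1 ∧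
    GreenL (igBar (leftCtx u (FreeSemigroup.of e))) (igBar (FreeSemigroup.of e)) ∧
    GreenR (igBar (FreeSemigroup.of e)) (igBar (rightCtx (FreeSemigroup.of e) v))

/-- The coordinate (position within `w` of the first letter) of the `i`-th factor. -/
def wcoord (p : ℕ → FreeSemigroup (IdemE S)) (i : ℕ) : ℕ :=
  1 + ∑ j ∈ Finset.Ico 1 i, wlen (p j)

end IGdef

/-- `ε` (an idempotent of `T`) represents a maximal regular 𝓓-class: there is no
regular 𝓓-class strictly 𝓙-above it, except that when `T` has an identity element `1`,
classes that are not strictly 𝓙-below the class `{1}` do not count. -/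
def IsMaxRegDClass {T : Type*} [Semigroup T] (ε : T) : Prop :=
  ∀ ε' : T, ε' * ε' = ε' → JltRel ε ε' →
    ∃ one : T, IsIdentityElem one ∧ ¬ JltRel ε' one

/-- Encode a word over `E` as a list over `Fin k`, via a bijection `ι : E ≃ Fin k`. -/
def encodeWord {S : Type*} [Semigroup S] {k : ℕ} (ι : IdemE S ≃ Fin k)
    (w : FreeSemigroup (IdemE S)) : List (Fin k) := (wordList w).map ι

namespace IGWord

variable {S : Type*} [Semigroup S]

/-- The generator of `IG(E)¹` given by an idempotent. -/
def letter (e : IdemE S) : WithOne (IG S) := ((igBar (FreeSemigroup.of e) : IG S) : WithOne (IG S))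

/-- The value of a (possibly empty) word in `IG(E)¹`. -/
def val (l : List (IdemE S)) : WithOne (IG S) := (l.map letter).prod

@[simp] theorem val_nil : val ([] : List (IdemE S)) = 1 := rfl

@[simp] theorem val_cons (e : IdemE S) (l : List (IdemE S)) : val (e :: l) = letter e * val l := by
  simp [val]

@[simp] theorem val_append (a b : List (IdemE S)) : val (a ++ b) = val a * val b := by
  simp [val]

/-- One contraction `xy → z` of a basic pair inside a word. -/
def Step (l l' : List (IdemE S)) : Prop :=
  ∃ (a b : List (IdemE S)) (x y z : IdemE S), BasicPair x y ∧ (z : S) = x * y ∧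
    l = a ++ x :: y :: b ∧ l' = a ++ z :: b

theorem letter_mul {x y z : IdemE S} (h : BasicPair x y) (hz : (z : S) = x * y) :
    letter x * letter y = letter z := by
  unfold letter
  rw [← WithOne.coe_mul]
  congr 1
  exact (Con.eq _).2 (ConGen.Rel.of _ _ ⟨x, y, z, h, hz, rfl, rfl⟩)

theorem letter_mul_eq_left {x y : IdemE S} (h : (x : S) * y = x) :
    letter x * letter y = letter x :=
  letter_mul (Or.inl h) h.symm

theorem letter_mul_eq_right {x y : IdemE S} (h : (x : S) * y = y) :
    letter x * letter y = letter y :=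
  letter_mul (Or.inr (Or.inl h)) h.symm

theorem letter_mul_self (x : IdemE S) : letter x * letter x = letter x :=
  letter_mul_eq_left x.2

theorem Step.val_eq {l l' : List (IdemE S)} (h : Step l l') : val l = val l' := by
  obtain ⟨a, b, x, y, z, hb, hz, rfl, rfl⟩ := h
  simp [← letter_mul hb hz, mul_assoc]

theorem Step.append {l l' : List (IdemE S)} (h : Step l l') (c d : List (IdemE S)) :
    Step (c ++ l ++ d) (c ++ l' ++ d) := by
  obtain ⟨a, b, x, y, z, hb, hz, rfl, rfl⟩ := h
  exact ⟨c ++ a, b ++ d, x, y, z, hb, hz, by simp, by simp⟩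

theorem Step.length_eq {l l' : List (IdemE S)} (h : Step l l') : l.length = l'.length + 1 := by
  obtain ⟨a, b, x, y, z, hb, hz, rfl, rfl⟩ := h
  simp; omega

theorem val_eq_of_eqvGen {l l' : List (IdemE S)} (h : Relation.EqvGen Step l l') :
    val l = val l' := by
  induction h with
  | rel _ _ h => exact h.val_eq
  | refl => rfl
  | symm _ _ _ ih => exact ih.symm
  | trans _ _ _ _ _ ih₁ ih₂ => exact ih₁.trans ih₂

theorem eqvGen_append {l l' : List (IdemE S)} (h : Relation.EqvGen Step l l')
    (c d : List (IdemE S)) : Relation.EqvGen Step (c ++ l ++ d) (c ++ l' ++ d) := by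
  induction h with
  | rel _ _ h => exact .rel _ _ (h.append c d)
  | refl => exact .refl _
  | symm _ _ _ ih => exact .symm _ _ ih
  | trans _ _ _ _ _ ih₁ ih₂ => exact .trans _ _ _ ih₁ ih₂

theorem wordList_mul (u v : FreeSemigroup (IdemE S)) :
    wordList (u * v) = wordList u ++ wordList v := rfl

theorem val_wordList (w : FreeSemigroup (IdemE S)) :
    val (wordList w) = ((igBar w : IG S) : WithOne (IG S)) := by
  induction w using FreeSemigroup.recOnMul with
  | ih1 x => simp [wordList, FreeSemigroup.of, letter]
  | ih2 x y hx hy =>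
    rw [wordList_mul, val_append, hy, hx]
    exact (WithOne.coe_mul _ _).symm

theorem exists_wordList {l : List (IdemE S)} (h : l ≠ []) :
    ∃ w : FreeSemigroup (IdemE S), wordList w = l := by
  cases l with
  | nil => exact absurd rfl h
  | cons a t => exact ⟨⟨a, t⟩, rfl⟩

theorem eqvGen_of_rel {u v : FreeSemigroup (IdemE S)}
    (h : ConGen.Rel (fun u v => igRelBase u v) u v) :
    Relation.EqvGen Step (wordList u) (wordList v) := by
  induction h with
  | of _ _ h =>
    obtain ⟨e, f, g, hb, hg, rfl, rfl⟩ := h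
    exact .rel _ _ ⟨[], [], e, f, g, hb, hg, rfl, rfl⟩
  | refl => exact .refl _
  | symm _ ih => exact .symm _ _ ih
  | trans _ _ ih₁ ih₂ => exact .trans _ _ _ ih₁ ih₂
  | mul _ _ ih₁ ih₂ =>
    rw [wordList_mul, wordList_mul]
    exact .trans _ _ _ (by simpa using eqvGen_append ih₁ [] _)
      (by simpa using eqvGen_append ih₂ _ [])

theorem igBar_eq_iff {u v : FreeSemigroup (IdemE S)} :
    igBar u = igBar v ↔ Relation.EqvGen Step (wordList u) (wordList v) := by
  constructor
  · exact fun h => eqvGen_of_rel ((Con.eq _).1 h)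
  · intro h
    have := val_eq_of_eqvGen h
    rwa [val_wordList, val_wordList, WithOne.coe_inj] at this

theorem val_ne_one {l : List (IdemE S)} (h : l ≠ []) : val l ≠ 1 := by
  obtain ⟨w, rfl⟩ := exists_wordList h
  rw [val_wordList]
  exact WithOne.coe_ne_one

theorem val_eq_iff {l l' : List (IdemE S)} : val l = val l' ↔ Relation.EqvGen Step l l' := by
  refine ⟨fun h => ?_, val_eq_of_eqvGen⟩
  by_cases hl : l = []
  · by_cases hl' : l' = []
    · subst hl hl'; exact .refl _
    · subst hl; exact absurd h.symm (val_ne_one hl')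
  · by_cases hl' : l' = []
    · subst hl'; exact absurd h (val_ne_one hl)
    · obtain ⟨w, rfl⟩ := exists_wordList hl
      obtain ⟨w', rfl⟩ := exists_wordList hl'
      rw [val_wordList, val_wordList, WithOne.coe_inj] at h
      exact igBar_eq_iff.1 h

theorem exists_val (x : WithOne (IG S)) : ∃ l : List (IdemE S), val l = x := by
  by_cases hx : x = 1
  · exact ⟨[], hx.symm⟩
  · obtain ⟨a, rfl⟩ := WithOne.ne_one_iff_exists.1 hx
    obtain ⟨w, rfl⟩ : ∃ w, igBar w = a := Con.induction_on a fun w => ⟨w, rfl⟩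
    exact ⟨wordList w, val_wordList w⟩

theorem lift_eq_of_rel {a b : FreeSemigroup (IdemE S)}
    (h : ConGen.Rel (fun u v => igRelBase u v) a b) :
    FreeSemigroup.lift (fun e : IdemE S => (e : S)) a =
      FreeSemigroup.lift (fun e : IdemE S => (e : S)) b := by
  induction h with
  | of _ _ h =>
    obtain ⟨e, f, g, hb, hg, rfl, rfl⟩ := h
    simp [hg]
  | refl => rfl
  | symm _ ih => exact ih.symm
  | trans _ _ ih₁ ih₂ => exact ih₁.trans ih₂
  | mul _ _ ih₁ ih₂ => rw [map_mul, map_mul, ih₁, ih₂]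

/-- The natural map `IG(E)¹ → S¹`. -/
noncomputable def toS : WithOne (IG S) →* WithOne S :=
  WithOne.mapMulHom
    { toFun := fun x => Con.liftOn x (FreeSemigroup.lift (fun e : IdemE S => (e : S)))
        (fun _ _ h => lift_eq_of_rel h)
      map_mul' := fun x y => Con.induction_on₂ x y fun a b => by
        simp only [← Con.coe_mul, Con.liftOn_coe, map_mul] }

@[simp] theorem toS_letter (e : IdemE S) : toS (letter e) = ((e : S) : WithOne S) := by
  simp only [toS, letter, WithOne.mapMulHom_coe]
  rfl

theorem eq_of_mul_eq {x y z : S} (h : ((x : S) : WithOne S) * (y : S) = (z : S)) : x * y = z := by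
  rwa [← WithOne.coe_mul, WithOne.coe_inj] at h

theorem mul_eq_of_letter {x y z : IdemE S} (h : letter x * letter y = letter z) :
    (x : S) * y = z := by
  have := congrArg toS h
  rw [map_mul, toS_letter, toS_letter, toS_letter] at this
  exact eq_of_mul_eq this

theorem append_cons_eq_append_append {α : Type*} {u w a m b : List α} {e : α}
    (h : u ++ e :: w = a ++ (m ++ b)) :
    (∃ c, a = u ++ e :: c ∧ w = c ++ (m ++ b)) ∨
      (∃ c d, m = c ++ e :: d ∧ u = a ++ c ∧ w = d ++ b) ∨
      (∃ c, b = c ++ e :: w ∧ u = a ++ (m ++ c)) := by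
  rcases List.append_eq_append_iff.1 h with ⟨c, rfl, h₂⟩ | ⟨c, rfl, h₂⟩
  · cases c with
    | nil =>
      simp only [List.nil_append] at h₂
      cases m with
      | nil => exact Or.inr (Or.inr ⟨[], by simpa using h₂.symm, by simp⟩)
      | cons f m =>
        obtain ⟨rfl, rfl⟩ := List.cons_eq_cons.1 h₂
        exact Or.inr (Or.inl ⟨[], m, rfl, by simp, rfl⟩)
    | cons f c =>
      obtain ⟨rfl, rfl⟩ := List.cons_eq_cons.1 h₂
      exact Or.inl ⟨c, rfl, rfl⟩
  · rcases List.append_eq_append_iff.1 h₂ with ⟨d, rfl, h₃⟩ | ⟨d, rfl, h₃⟩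
    · exact Or.inr (Or.inr ⟨d, h₃, by simp⟩)
    · cases d with
      | nil => exact Or.inr (Or.inr ⟨[], by simpa using h₃.symm, by simp⟩)
      | cons f d =>
        obtain ⟨rfl, rfl⟩ := List.cons_eq_cons.1 h₃
        exact Or.inr (Or.inl ⟨c, d, rfl, rfl, rfl⟩)

/-- A word is seeded if it has a letter `e` whose prefix up to `e` is `𝓛`-related to `e` and
whose suffix from `e` is `𝓡`-related to `e`. -/
def Seeded (l : List (IdemE S)) : Prop :=
  ∃ (u : List (IdemE S)) (e : IdemE S) (w : List (IdemE S)) (X Y : WithOne (IG S)),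
    l = u ++ e :: w ∧ X * val u * letter e = letter e ∧ letter e * val w * Y = letter e

theorem Seeded.ne_nil {l : List (IdemE S)} (h : Seeded l) : l ≠ [] := by
  obtain ⟨u, e, w, X, Y, rfl, -⟩ := h
  simp

theorem Seeded.contract {a b : List (IdemE S)} {x y z : IdemE S} (hb : BasicPair x y)
    (hz : (z : S) = x * y) (h : Seeded (a ++ x :: y :: b)) : Seeded (a ++ z :: b) := by
  obtain ⟨u, e, w, X, Y, hl, hu, hw⟩ := h
  have hxy := letter_mul hb hz
  rcases append_cons_eq_append_append (m := [x, y]) (b := b) hl.symm with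
    ⟨c, rfl, rfl⟩ | ⟨c, d, hm, rfl, rfl⟩ | ⟨c, rfl, rfl⟩
  · refine ⟨u, e, c ++ z :: b, X, Y, by simp, hu, ?_⟩
    simpa [← hxy, mul_assoc] using hw
  · rcases c with _ | ⟨c₁, _ | ⟨c₂, c⟩⟩
    · obtain ⟨rfl, rfl⟩ : x = e ∧ [y] = d := by simpa using hm
      refine ⟨a, z, b, X, Y * letter y, rfl, ?_, ?_⟩
      · rw [← hxy, ← mul_assoc, ← List.append_nil a, hu]
      · have h' : letter x * letter y * val b * Y = letter x := by simpa [mul_assoc] using hw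
        rw [← mul_assoc, ← hxy, h']
    · obtain ⟨rfl, rfl, rfl⟩ : x = c₁ ∧ y = e ∧ [] = d := by simpa using hm
      refine ⟨a, z, b, letter x * X, Y, rfl, ?_, ?_⟩
      · have h' : X * val a * (letter x * letter y) = letter y := by
          simpa [mul_assoc] using hu
        rw [mul_assoc _ X, mul_assoc, ← hxy, h']
      · rw [← hxy]
        simp only [mul_assoc] at hw ⊢
        simpa using congrArg (letter x * ·) hw
    · simp at hm
  · refine ⟨a ++ z :: c, e, w, X, Y, by simp, ?_, hw⟩
    simpa [← hxy, mul_assoc] using hu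

theorem Seeded.expand {a b : List (IdemE S)} {x y z : IdemE S} (hb : BasicPair x y)
    (hz : (z : S) = x * y) (h : Seeded (a ++ z :: b)) : Seeded (a ++ x :: y :: b) := by
  obtain ⟨u, e, w, X, Y, hl, hu, hw⟩ := h
  have hxy := letter_mul hb hz
  rcases append_cons_eq_append_append (m := [z]) (b := b) hl.symm with
    ⟨c, rfl, rfl⟩ | ⟨c, d, hm, rfl, rfl⟩ | ⟨c, rfl, rfl⟩
  · refine ⟨u, e, c ++ x :: y :: b, X, Y, by simp, hu, ?_⟩
    simpa [← hxy, mul_assoc] using hw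
  · obtain ⟨rfl, rfl, rfl⟩ : c = [] ∧ z = e ∧ [] = d := by
      cases c <;> simp_all
    simp only [List.append_nil, List.nil_append] at hu hw
    have hyy := letter_mul_self y
    have hxx := letter_mul_self x
    have key1 : letter y * letter x = letter y → Seeded (a ++ x :: y :: b) := by
      intro h
      refine ⟨a ++ [x], y, b, letter y * X, Y, by simp, ?_, ?_⟩
      · simp only [val_append, val_cons, val_nil, mul_one]
        calc letter y * X * (val a * letter x) * letter y
            = letter y * (X * val a * (letter x * letter y)) := by simp only [mul_assoc]
          _ = letter y := by rw [hxy, hu, ← hxy, ← mul_assoc, h, hyy]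
      · have : letter y = letter y * letter z := by rw [← hxy, ← mul_assoc, h, hyy]
        rw [this, mul_assoc, mul_assoc, ← mul_assoc (letter z), hw]
    have key2 : letter y * letter x = letter x → Seeded (a ++ x :: y :: b) := by
      intro h
      have hzx : letter z * letter x = letter x := by rw [← hxy, mul_assoc, h, hxx]
      refine ⟨a, x, y :: b, X, Y * letter x, by simp, ?_, ?_⟩
      · rw [← hzx, ← mul_assoc, hu]
      · simp only [val_cons]
        calc letter x * (letter y * val b) * (Y * letter x)
            = (letter x * letter y * val b * Y) * letter x := by simp only [mul_assoc]
          _ = letter x := by rw [hxy, hw, hzx]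
    rcases hb with h | h | h | h
    · obtain rfl : z = x := Subtype.ext (hz.trans h)
      refine ⟨a, z, y :: b, X, Y, rfl, hu, ?_⟩
      rw [val_cons, ← mul_assoc, hxy, hw]
    · obtain rfl : z = y := Subtype.ext (hz.trans h)
      refine ⟨a ++ [x], z, b, X, Y, by simp, ?_, hw⟩
      simp only [val_append, val_cons, val_nil, mul_one]
      rw [mul_assoc, mul_assoc, hxy, ← mul_assoc, hu]
    · exact key2 (letter_mul_eq_right h)
    · exact key1 (letter_mul_eq_left h)
  · refine ⟨a ++ x :: y :: c, e, w, X, Y, by simp, ?_, hw⟩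
    simpa [← hxy, mul_assoc] using hu

theorem Seeded.append_right {P : List (IdemE S)} (h : Seeded P) (Q : List (IdemE S))
    {Y : WithOne (IG S)} (hY : val P * val Q * Y = val P) : Seeded (P ++ Q) := by
  obtain ⟨u, e, w, X, Y', rfl, hu, hw⟩ := h
  refine ⟨u, e, w ++ Q, X, Y * Y', by simp, hu, ?_⟩
  simp only [val_append, val_cons] at hY ⊢
  have h₁ : X * (val u * (letter e * val w)) = letter e * val w := by
    rw [← mul_assoc, ← mul_assoc, hu]
  have h₂ : letter e * val w * val Q * Y = letter e * val w := by
    rw [← h₁]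
    nth_rewrite 2 [← hY]
    simp only [mul_assoc]
  rw [← mul_assoc, ← mul_assoc, h₂, hw]

theorem Seeded.append_left {Q : List (IdemE S)} (h : Seeded Q) (P : List (IdemE S))
    {X : WithOne (IG S)} (hX : X * val P * val Q = val Q) : Seeded (P ++ Q) := by
  obtain ⟨u, e, w, X', Y, rfl, hu, hw⟩ := h
  refine ⟨P ++ u, e, w, X' * X, Y, by simp, ?_, hw⟩
  simp only [val_append, val_cons] at hX ⊢
  have h₁ : val u * (letter e * val w) * Y = val u * letter e := by
    rw [mul_assoc, hw]
  have h₂ : X * (val P * (val u * letter e)) = val u * letter e := by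
    rw [← h₁]
    nth_rewrite 2 [← hX]
    simp only [mul_assoc]
  rw [mul_assoc, mul_assoc, mul_assoc, h₂, ← mul_assoc, hu]

theorem Seeded.of_concat {a : List (IdemE S)} {x : IdemE S} (h : Seeded (a ++ [x])) :
    (Seeded a ∧ ∃ s, val a = val (a ++ [x]) * s) ∨ ∃ X, X * val a * letter x = letter x := by
  obtain ⟨u, e, w, X, Y, hl, hu, hw⟩ := h
  rcases List.eq_nil_or_concat w with rfl | ⟨w, f, rfl⟩
  · obtain ⟨rfl, rfl⟩ : a = u ∧ x = e := by simpa using hl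
    exact Or.inr ⟨X, hu⟩
  · obtain ⟨rfl, rfl⟩ : a = u ++ e :: w ∧ x = f := by
      have : a ++ [x] = (u ++ e :: w) ++ [f] := by simpa using hl
      simpa using List.append_inj' this rfl
    simp only [List.concat_eq_append, val_append, val_cons, val_nil, mul_one] at hw
    refine Or.inl ⟨⟨u, e, w, X, letter x * Y, rfl, hu, ?_⟩, Y * val w, ?_⟩
    · simpa only [mul_assoc] using hw
    · simp only [val_append, val_cons, val_nil, mul_one]
      calc val u * (letter e * val w)
          = val u * ((letter e * (val w * letter x) * Y) * val w) := by rw [hw]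
        _ = _ := by simp only [mul_assoc]

theorem Seeded.of_cons {b : List (IdemE S)} {y : IdemE S} (h : Seeded (y :: b)) :
    (Seeded b ∧ ∃ t, val b = t * val (y :: b)) ∨ ∃ Y, letter y * val b * Y = letter y := by
  obtain ⟨u, e, w, X, Y, hl, hu, hw⟩ := h
  cases u with
  | nil =>
    obtain ⟨rfl, rfl⟩ : y = e ∧ b = w := by simpa using hl
    exact Or.inr ⟨Y, hw⟩
  | cons f u =>
    obtain ⟨rfl, rfl⟩ : y = f ∧ b = u ++ e :: w := by simpa using hl
    simp only [val_cons] at hu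
    refine Or.inl ⟨⟨u, e, w, X * letter y, Y, rfl, ?_, hw⟩, val u * X, ?_⟩
    · simpa only [mul_assoc] using hu
    · simp only [val_append, val_cons]
      calc val u * (letter e * val w)
          = val u * ((X * (letter y * val u) * letter e) * val w) := by rw [hu]
        _ = _ := by simp only [mul_assoc]

/-- The pair `(p, q)` becomes `(p', q')` by moving an idempotent from the right end of the first
entry to the left end of the second one, staying in the same `𝓡`-class, resp. `𝓛`-class. -/
def Shift (p q p' q' : WithOne (IG S)) : Prop :=
  ∃ a : IdemE S, p = p' * letter a ∧ q' = letter a * q ∧ (∃ s, p' = p * s) ∧ ∃ t, q = t * q'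

theorem Seeded.boundary {a b : List (IdemE S)} {x y z : IdemE S} (hb : BasicPair x y)
    (hz : (z : S) = x * y) (hP : Seeded (a ++ [x])) (hQ : Seeded (y :: b)) :
    Seeded (a ++ z :: b) ∨ ∃ p' q', Seeded p' ∧ Seeded q' ∧ p' ++ q' = a ++ z :: b ∧
      (Shift (val (a ++ [x])) (val (y :: b)) (val p') (val q') ∨
        Shift (val p') (val q') (val (a ++ [x])) (val (y :: b))) := by
  have hxy := letter_mul hb hz
  have hxx := letter_mul_self x
  have hyy := letter_mul_self y
  have hPQ : (a ++ [x]) ++ (y :: b) = a ++ x :: y :: b := by simp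
  have mergeR : (∃ Y, val (a ++ [x]) * val (y :: b) * Y = val (a ++ [x])) →
      Seeded (a ++ z :: b) := fun ⟨Y, hY⟩ =>
    Seeded.contract hb hz (hPQ ▸ hP.append_right (y :: b) hY)
  have mergeL : (∃ X, X * val (a ++ [x]) * val (y :: b) = val (y :: b)) →
      Seeded (a ++ z :: b) := fun ⟨X, hX⟩ =>
    Seeded.contract hb hz (hPQ ▸ hQ.append_left (a ++ [x]) hX)
  have left : letter z * letter x = letter x → Seeded (a ++ z :: b) ∨ ∃ p' q',
      Seeded p' ∧ Seeded q' ∧ p' ++ q' = a ++ z :: b ∧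
      (Shift (val (a ++ [x])) (val (y :: b)) (val p') (val q') ∨
        Shift (val p') (val q') (val (a ++ [x])) (val (y :: b))) := by
    intro h
    rcases hQ.of_cons with ⟨hb', t, ht⟩ | ⟨Y, hY⟩
    · refine Or.inr ⟨a ++ [z], b, ?_, hb', by simp, Or.inr ⟨y, ?_, by simp, ⟨letter x, ?_⟩, t, ht⟩⟩
      · refine Seeded.contract (b := []) hb hz ?_
        have := hP.append_right [y] (Y := letter x) (by
          simp only [val_append, val_cons, val_nil, mul_one]
          rw [mul_assoc, mul_assoc, ← mul_assoc (letter x), hxy, h])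
        simpa using this
      · simp [← hxy, mul_assoc]
      · simp [mul_assoc, h]
    · refine Or.inl (mergeR ⟨Y * letter x, ?_⟩)
      simp only [val_append, val_cons, val_nil, mul_one]
      calc val a * letter x * (letter y * val b) * (Y * letter x)
          = val a * (letter x * (letter y * val b * Y) * letter x) := by simp only [mul_assoc]
        _ = val a * letter x := by rw [hY, hxy, h]
  have right : letter y * letter z = letter y → Seeded (a ++ z :: b) ∨ ∃ p' q',
      Seeded p' ∧ Seeded q' ∧ p' ++ q' = a ++ z :: b ∧
      (Shift (val (a ++ [x])) (val (y :: b)) (val p') (val q') ∨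
        Shift (val p') (val q') (val (a ++ [x])) (val (y :: b))) := by
    intro h
    rcases hP.of_concat with ⟨ha, s, hs⟩ | ⟨X, hX⟩
    · refine Or.inr ⟨a, z :: b, ha, ?_, by simp, Or.inl ⟨x, by simp, ?_, ⟨s, hs⟩, letter y, ?_⟩⟩
      · refine Seeded.contract (a := []) hb hz ?_
        refine hQ.append_left [x] (X := letter y) ?_
        simp only [val_cons, val_nil, mul_one]
        rw [← mul_assoc, mul_assoc (letter y), hxy, h]
      · simp [← hxy, mul_assoc]
      · simp [← mul_assoc, h]
    · refine Or.inl (mergeL ⟨letter y * X, ?_⟩)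
      simp only [val_append, val_cons, val_nil, mul_one]
      calc letter y * X * (val a * letter x) * (letter y * val b)
          = letter y * (X * val a * letter x * letter y) * val b := by simp only [mul_assoc]
        _ = letter y * val b := by rw [hX, hxy, h]
  rcases hb with h | h | h | h
  · refine left ?_
    rw [← hxy, letter_mul_eq_left h, hxx]
  · refine right ?_
    rw [← hxy, letter_mul_eq_right h, hyy]
  · refine left ?_
    rw [← hxy, mul_assoc, letter_mul_eq_right h, hxx]
  · refine right ?_
    rw [← hxy, ← mul_assoc, letter_mul_eq_left h, hyy]

/-- A factorisation of a word into seeded blocks. -/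
def IsFact (l : List (IdemE S)) (Ps : List (List (IdemE S))) : Prop :=
  Ps.flatten = l ∧ ∀ P ∈ Ps, Seeded P

theorem isFact_singletons (l : List (IdemE S)) : IsFact l (l.map fun e => [e]) := by
  refine ⟨by induction l <;> simp_all, fun P hP => ?_⟩
  obtain ⟨e, -, rfl⟩ := List.mem_map.1 hP
  exact ⟨[], e, [], 1, 1, rfl, by simp, by simp⟩

theorem IsFact.length_le {l : List (IdemE S)} {Ps : List (List (IdemE S))} (h : IsFact l Ps) :
    Ps.length ≤ l.length := by
  obtain ⟨rfl, hs⟩ := h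
  induction Ps with
  | nil => simp
  | cons P Ps ih =>
    have h₁ := ih fun Q hQ => hs Q (List.mem_cons_of_mem _ hQ)
    have h₂ := List.length_pos_iff.2 (hs P List.mem_cons_self).ne_nil
    simp only [List.length_cons, List.flatten_cons, List.length_append]
    omega

/-- Two consecutive blocks are altered by a shift. -/
def Move (Ps Ps' : List (List (IdemE S))) : Prop :=
  ∃ A B p q p' q', Ps = A ++ p :: q :: B ∧ Ps' = A ++ p' :: q' :: B ∧
    Shift (val p) (val q) (val p') (val q')

theorem IsFact.expand {l l' : List (IdemE S)} (h : Step l l') {Ps : List (List (IdemE S))}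
    (hf : IsFact l' Ps) : ∃ Ps', IsFact l Ps' ∧ Ps'.map val = Ps.map val := by
  obtain ⟨a, b, x, y, z, hb, hz, rfl, rfl⟩ := h
  obtain ⟨hl, hs⟩ := hf
  have hxy := letter_mul hb hz
  obtain ⟨A, a', b', B, rfl, rfl, rfl⟩ : ∃ A a' b' B, Ps = A ++ (a' ++ z :: b') :: B ∧
      a = A.flatten ++ a' ∧ b = b' ++ B.flatten := by
    rcases List.flatten_eq_append_iff.1 hl with
      ⟨A, B, rfl, rfl, hB⟩ | ⟨A, a', c, b', B, rfl, rfl, h⟩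
    · obtain ⟨A', b', B', rfl, hA', rfl⟩ := List.flatten_eq_cons_iff.1 hB.symm
      have : A' = [] := by
        refine List.eq_nil_iff_forall_not_mem.2 fun P hP => ?_
        exact (hs P (by simp [hP])).ne_nil (hA' P hP)
      subst this
      exact ⟨A, [], b', B', by simp, by simp, rfl⟩
    · obtain ⟨rfl, rfl⟩ : z = c ∧ b = b' ++ B.flatten := by simpa using h
      exact ⟨A, a', b', B, rfl, rfl, rfl⟩
  refine ⟨A ++ (a' ++ x :: y :: b') :: B, ⟨by simp, fun P hP => ?_⟩, ?_⟩
  · rcases List.mem_append.1 hP with hP | hP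
    · exact hs P (by simp [hP])
    · rcases List.mem_cons.1 hP with rfl | hP
      · exact (hs (a' ++ z :: b') (by simp)).expand hb hz
      · exact hs P (by simp [hP])
  · simp [← hxy, mul_assoc]

theorem IsFact.contract {l l' : List (IdemE S)} (h : Step l l') {Ps : List (List (IdemE S))}
    (hf : IsFact l Ps) : ∃ Ps', IsFact l' Ps' ∧ (Ps'.length < Ps.length ∨
      Ps'.length = Ps.length ∧ (Ps'.map val = Ps.map val ∨ Move Ps Ps' ∨ Move Ps' Ps)) := by
  obtain ⟨a, b, x, y, z, hb, hz, rfl, rfl⟩ := h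
  obtain ⟨hl, hs⟩ := hf
  have hxy := letter_mul hb hz
  have cases : (∃ A a' b' B, Ps = A ++ (a' ++ x :: y :: b') :: B ∧
      a = A.flatten ++ a' ∧ b = b' ++ B.flatten) ∨
      ∃ A a' b' B, Ps = A ++ (a' ++ [x]) :: (y :: b') :: B ∧
      a = A.flatten ++ a' ∧ b = b' ++ B.flatten := by
    have hnil : ∀ A' : List (List (IdemE S)), (∀ P ∈ A', P ∈ Ps) → (∀ P ∈ A', P = []) → A' = [] :=
      fun A' h₁ h₂ => List.eq_nil_iff_forall_not_mem.2 fun P hP =>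
        (hs P (h₁ P hP)).ne_nil (h₂ P hP)
    have hy : ∀ A' B' : List (List (IdemE S)), (∀ P ∈ B', P ∈ Ps) → B'.flatten = y :: b →
        ∃ b' B, B' = (y :: b') :: B ∧ b = b' ++ B.flatten := by
      intro A' B' h₁ h₂
      obtain ⟨A'', b', B'', rfl, hA'', rfl⟩ := List.flatten_eq_cons_iff.1 h₂
      obtain rfl := hnil A'' (fun P hP => h₁ P (by simp [hP])) hA''
      exact ⟨b', B'', rfl, rfl⟩
    have hx : ∃ A a' c B, Ps = A ++ (a' ++ x :: c) :: B ∧ a = A.flatten ++ a' ∧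
        y :: b = c ++ B.flatten := by
      rcases List.flatten_eq_append_iff.1 hl with
        ⟨A, B, rfl, rfl, hB⟩ | ⟨A, a', c, b', B, rfl, rfl, h⟩
      · obtain ⟨A', b', B', rfl, hA', h⟩ := List.flatten_eq_cons_iff.1 hB.symm
        obtain rfl := hnil A' (fun P hP => by simp [hP]) hA'
        exact ⟨A, [], b', B', by simp, by simp, h⟩
      · obtain ⟨rfl, h'⟩ := List.cons_eq_cons.1 (h.trans (List.cons_append ..))
        exact ⟨A, a', b', B, rfl, rfl, h'⟩
    obtain ⟨A, a', c, B, rfl, rfl, h⟩ := hx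
    cases c with
    | nil =>
      obtain ⟨b', B', rfl, rfl⟩ := hy A B (fun P hP => by simp [hP]) h.symm
      exact Or.inr ⟨A, a', b', B', rfl, rfl, rfl⟩
    | cons c₀ c =>
      obtain ⟨rfl, rfl⟩ : y = c₀ ∧ b = c ++ B.flatten := by simpa using h
      exact Or.inl ⟨A, a', c, B, rfl, rfl, rfl⟩
  rcases cases with ⟨A, a', b', B, rfl, rfl, rfl⟩ | ⟨A, a', b', B, rfl, rfl, rfl⟩
  · refine ⟨A ++ (a' ++ z :: b') :: B, ⟨by simp, fun P hP => ?_⟩, Or.inr ⟨by simp, Or.inl ?_⟩⟩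
    · rcases List.mem_append.1 hP with hP | hP
      · exact hs P (by simp [hP])
      · rcases List.mem_cons.1 hP with rfl | hP
        · exact (hs (a' ++ x :: y :: b') (by simp)).contract hb hz
        · exact hs P (by simp [hP])
    · simp [← hxy, mul_assoc]
  · rcases Seeded.boundary hb hz (hs (a' ++ [x]) (by simp)) (hs (y :: b') (by simp)) with
      h | ⟨p', q', hp, hq, hpq, h⟩
    · refine ⟨A ++ (a' ++ z :: b') :: B, ⟨by simp, fun P hP => ?_⟩, Or.inl (by simp)⟩
      rcases List.mem_append.1 hP with hP | hP
      · exact hs P (by simp [hP])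
      · rcases List.mem_cons.1 hP with rfl | hP
        · exact h
        · exact hs P (by simp [hP])
    · refine ⟨A ++ p' :: q' :: B, ⟨?_, fun P hP => ?_⟩, Or.inr ⟨by simp, Or.inr ?_⟩⟩
      · simp only [List.flatten_append, List.flatten_cons, List.append_assoc]
        rw [← List.append_assoc p', hpq]
        simp
      · rcases List.mem_append.1 hP with hP | hP
        · exact hs P (by simp [hP])
        · rcases List.mem_cons.1 hP with rfl | hP
          · exact hp
          · rcases List.mem_cons.1 hP with rfl | hP
            · exact hq
            · exact hs P (by simp [hP])
      · exact h.imp (fun h => ⟨A, B, _, _, _, _, rfl, rfl, h⟩)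
          (fun h => ⟨A, B, _, _, _, _, rfl, rfl, h⟩)

theorem exists_isFact_of_eqvGen {l l' : List (IdemE S)} (h : Relation.EqvGen Step l l') :
    (∀ Ps, IsFact l Ps → ∃ Ps', IsFact l' Ps' ∧ Ps'.length ≤ Ps.length) ∧
      ∀ Ps, IsFact l' Ps → ∃ Ps', IsFact l Ps' ∧ Ps'.length ≤ Ps.length := by
  induction h with
  | rel _ _ h =>
    refine ⟨fun Ps hP => ?_, fun Ps hP => ?_⟩
    · obtain ⟨Ps', h', h''⟩ := hP.contract h
      exact ⟨Ps', h', by omega⟩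
    · obtain ⟨Ps', h', h''⟩ := hP.expand h
      exact ⟨Ps', h', by simpa using (congrArg List.length h'').le⟩
  | refl => exact ⟨fun Ps hP => ⟨Ps, hP, le_rfl⟩, fun Ps hP => ⟨Ps, hP, le_rfl⟩⟩
  | symm _ _ _ ih => exact ih.symm
  | trans _ _ _ _ _ ih₁ ih₂ =>
    refine ⟨fun Ps hP => ?_, fun Ps hP => ?_⟩
    · obtain ⟨Ps₁, h₁, h₁'⟩ := ih₁.1 Ps hP
      obtain ⟨Ps₂, h₂, h₂'⟩ := ih₂.1 Ps₁ h₁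
      exact ⟨Ps₂, h₂, h₂'.trans h₁'⟩
    · obtain ⟨Ps₁, h₁, h₁'⟩ := ih₂.2 Ps hP
      obtain ⟨Ps₂, h₂, h₂'⟩ := ih₁.2 Ps₁ h₁
      exact ⟨Ps₂, h₂, h₂'.trans h₁'⟩

theorem finite_idempotents_withOne [Finite (IdemE S)] :
    Finite {x : WithOne S // x * x = x} := by
  refine (Set.Finite.subset (Set.finite_range fun o : Option (IdemE S) =>
    o.elim (1 : WithOne S) fun e => ((e : S) : WithOne S)) fun x hx => ?_).to_subtype
  by_cases h : x = 1
  · exact ⟨none, h.symm⟩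
  · obtain ⟨a, rfl⟩ := WithOne.ne_one_iff_exists.1 h
    exact ⟨some ⟨a, eq_of_mul_eq hx⟩, rfl⟩

/-- In a monoid with finitely many idempotents, `𝓙`-equivalent comparable idempotents agree. -/
theorem eq_of_idempotent_factor {M : Type*} [Monoid M] [Finite {x : M // x * x = x}]
    {g h x y : M} (hg : g * g = g) (hh : h * h = h) (hhg : h * g = h) (hgh : g * h = h)
    (hgx : g = x * h * y) :
    h = g := by
  set c := g * x * h with hc
  set d := h * y * g with hd
  have hcd : c * d = g := by
    calc c * d = g * (x * (h * h) * y) * g := by simp only [hc, hd, mul_assoc]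
      _ = g := by rw [hh, ← hgx, hg, hg]
  have hgc : g * c = c := by simp only [hc, ← mul_assoc, hg]
  have hcg : c * g = c := by simp only [hc, mul_assoc, hhg]
  have hgd : g * d = d := by simp only [hd, ← mul_assoc, hgh]
  have hdg : d * g = d := by simp only [hd, mul_assoc, hg]
  have hhd : h * d = d := by simp only [hd, ← mul_assoc, hh]
  have hC : ∀ n : ℕ, c ^ n * g = g * c ^ n := fun n =>
    ((show Commute c g from hcg.trans hgc.symm).pow_left n)
  have hD : ∀ n : ℕ, d ^ n * g = g * d ^ n := fun n =>
    ((show Commute d g from hdg.trans hgd.symm).pow_left n)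
  have hpow : ∀ n : ℕ, c ^ n * g * d ^ n = g := by
    intro n
    induction n with
    | zero => simp
    | succ n ih =>
      calc c ^ (n + 1) * g * d ^ (n + 1) = c ^ n * ((c * g) * d) * d ^ n := by
            simp only [pow_succ c, pow_succ' d, mul_assoc]
        _ = g := by rw [hcg, hcd, ih]
  have hpow' : ∀ n : ℕ, c ^ n * d ^ n * g = g := by
    intro n
    rw [mul_assoc, hD, ← mul_assoc, hpow]
  have hidem : ∀ n : ℕ, (d ^ n * g * c ^ n) * (d ^ n * g * c ^ n) = d ^ n * g * c ^ n := by
    intro n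
    calc (d ^ n * g * c ^ n) * (d ^ n * g * c ^ n)
        = d ^ n * g * (c ^ n * d ^ n * g) * c ^ n := by simp only [mul_assoc]
      _ = _ := by rw [hpow', mul_assoc _ g g, hg]
  obtain ⟨n, m, hnm, h'⟩ := Finite.exists_ne_map_eq_of_infinite
    (fun n : ℕ => (⟨_, hidem n⟩ : {x : M // x * x = x}))
  have key : ∀ n m : ℕ, n < m → d ^ n * g * c ^ n = d ^ m * g * c ^ m → h = g := by
    intro n m hnm h'
    obtain ⟨k, rfl⟩ := Nat.exists_eq_add_of_lt hnm
    have h₁ : c ^ n * (d ^ n * g * c ^ n) * g * d ^ n = g := by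
      calc _ = c ^ n * d ^ n * g * (c ^ n * g * d ^ n) := by simp only [mul_assoc]
        _ = g := by rw [hpow', hpow, hg]
    have h₂ : c ^ n * (d ^ (n + k + 1) * g * c ^ (n + k + 1)) * g * d ^ n =
        d * (d ^ k * g * c ^ (n + k + 1) * g * d ^ n) := by
      calc _ = c ^ n * d ^ n * d * (d ^ k * g * c ^ (n + k + 1) * g * d ^ n) := by
            rw [add_assoc, pow_add d n, pow_succ' d]
            simp only [mul_assoc]
        _ = c ^ n * d ^ n * g * d * (d ^ k * g * c ^ (n + k + 1) * g * d ^ n) := by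
            rw [mul_assoc _ g d, hgd]
        _ = _ := by rw [hpow', hgd]
    have h₃ : g = d * (d ^ k * g * c ^ (n + k + 1) * g * d ^ n) := by
      rw [← h₂, ← h', h₁]
    rw [← hhg, h₃, ← mul_assoc, hhd]
  rcases lt_or_gt_of_ne hnm with hlt | hlt
  · exact key n m hlt (congrArg Subtype.val h')
  · exact key m n hlt (congrArg Subtype.val h').symm

theorem eq_of_letter_factor [Finite (IdemE S)] {g h : IdemE S} {X Y : WithOne (IG S)}
    (hhg : (h : S) * g = h) (hgh : (g : S) * h = h) (hg : letter g = X * letter h * Y) :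
    h = g := by
  have := finite_idempotents_withOne (S := S)
  have h' := congrArg toS hg
  simp only [map_mul, toS_letter] at h'
  have := eq_of_idempotent_factor (g := ((g : S) : WithOne S)) (h := ((h : S) : WithOne S))
    (by rw [← WithOne.coe_mul, g.2]) (by rw [← WithOne.coe_mul, h.2])
    (by rw [← WithOne.coe_mul, hhg])
    (by rw [← WithOne.coe_mul, hgh]) h'
  exact Subtype.ext (WithOne.coe_inj.1 this)

/-- Every generator `𝓙`-above `x` is `𝓙`-equivalent to `x` or acts as an identity. -/
def IsTop (x : WithOne (IG S)) : Prop :=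
  ∀ f : IdemE S, (∃ s t, x = s * letter f * t) → (∃ s t, letter f = s * x * t) ∨
    ∀ g : IdemE S, letter f * letter g = letter g ∧ letter g * letter f = letter g

theorem IsTop.of_dvd {x y : WithOne (IG S)} (h : IsTop x) (hxy : ∃ s t, x = s * y * t)
    (hyx : ∃ s t, y = s * x * t) : IsTop y := by
  obtain ⟨s, t, hst⟩ := hxy
  obtain ⟨s', t', hst'⟩ := hyx
  rintro f ⟨a, b, hab⟩
  refine (h f ⟨s * a, b * t, by rw [hst, hab]; simp only [mul_assoc]⟩).imp_left ?_
  rintro ⟨c, d, hcd⟩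
  exact ⟨c * s, t * d, by rw [hcd, hst]; simp only [mul_assoc]⟩

theorem eq_one_or_coe {T : Type*} (x : WithOne T) : x = 1 ∨ ∃ a : T, x = a := by
  by_cases h : x = 1
  · exact Or.inl h
  · obtain ⟨a, ha⟩ := WithOne.ne_one_iff_exists.1 h
    exact Or.inr ⟨a, ha.symm⟩

theorem mem_principalIdeal_iff {T : Type*} [Semigroup T] {a x : T} :
    x ∈ principalIdeal a ↔ ∃ s t : WithOne T, (x : WithOne T) = s * a * t := by
  constructor
  · rintro (rfl | ⟨u, rfl⟩ | ⟨v, rfl⟩ | ⟨u, v, rfl⟩)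
    · exact ⟨1, 1, by simp⟩
    · exact ⟨u, 1, by simp⟩
    · exact ⟨1, v, by simp⟩
    · exact ⟨u, v, by simp⟩
  · rintro ⟨s, t, h⟩
    rcases eq_one_or_coe s with rfl | ⟨s, rfl⟩
    · rcases eq_one_or_coe t with rfl | ⟨t, rfl⟩
      · exact Or.inl (by simpa using h)
      · rw [one_mul, ← WithOne.coe_mul, WithOne.coe_inj] at h
        exact Or.inr (Or.inr (Or.inl ⟨t, h.symm⟩))
    · rcases eq_one_or_coe t with rfl | ⟨t, rfl⟩
      · rw [mul_one, ← WithOne.coe_mul, WithOne.coe_inj] at h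
        exact Or.inr (Or.inl ⟨s, h.symm⟩)
      · rw [← WithOne.coe_mul, ← WithOne.coe_mul, WithOne.coe_inj] at h
        exact Or.inr (Or.inr (Or.inr ⟨s, t, h.symm⟩))

theorem jleRel_iff {T : Type*} [Semigroup T] {a b : T} :
    JleRel a b ↔ ∃ s t : WithOne T, (a : WithOne T) = s * b * t := by
  rw [← mem_principalIdeal_iff]
  refine ⟨fun h => h (Or.inl rfl), fun h x hx => ?_⟩
  rw [mem_principalIdeal_iff] at h hx ⊢
  obtain ⟨s, t, h⟩ := h
  obtain ⟨s', t', hx⟩ := hx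
  exact ⟨s' * s, t * t', by rw [hx, h]; simp only [mul_assoc]⟩

theorem letter_eq_of_val_eq_identity {o : WithOne (IG S)}
    (ho : ∀ g : IdemE S, o * letter g = letter g ∧ letter g * o = letter g)
    {u w : List (IdemE S)} {f : IdemE S} (h : val (u ++ f :: w) = o) : letter f = o := by
  have first : ∀ (g : IdemE S) (l : List (IdemE S)), val (g :: l) = o → letter g = o := by
    intro g l hl
    rw [← (ho g).2, ← hl, val_cons, ← mul_assoc, letter_mul_self]
  induction u with
  | nil => exact first _ _ h
  | cons g u ih =>
    refine ih ?_
    have hg := first g _ h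
    have h' : o * val (u ++ f :: w) = o := by rw [← hg, ← val_cons]; exact h.trans hg.symm
    rw [← h']
    cases u <;> simp [← mul_assoc, (ho _).1]

theorem not_isMaxRegDClass {e : IdemE S} (h : ¬ IsTop (letter e)) :
    ¬ IsMaxRegDClass (igBar (FreeSemigroup.of e) : IG S) := by
  unfold IsTop at h
  push Not at h
  obtain ⟨f, hef, hfe, g, hg⟩ := h
  intro hmax
  obtain ⟨one, h₁, hone⟩ := hmax (igBar (FreeSemigroup.of f))
    (WithOne.coe_inj.1 (letter_mul_self f))
    ⟨jleRel_iff.2 hef, fun h => by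
      obtain ⟨s, t, h⟩ := jleRel_iff.1 h
      exact hfe s t h⟩
  have ho : ∀ g : IdemE S, (one : WithOne (IG S)) * letter g = letter g ∧
      letter g * (one : WithOne (IG S)) = letter g := fun g => by
    constructor
    · exact congrArg WithOne.coe (h₁ (igBar (FreeSemigroup.of g))).1
    · exact congrArg WithOne.coe (h₁ (igBar (FreeSemigroup.of g))).2
  have hle : JleRel (igBar (FreeSemigroup.of f) : IG S) one :=
    jleRel_iff.2 ⟨letter f, 1, by rw [(ho f).2, mul_one]; rfl⟩
  obtain ⟨s, t, hst⟩ := jleRel_iff.1 (not_not.1 fun h => hone ⟨hle, h⟩)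
  obtain ⟨u, rfl⟩ := exists_val s
  obtain ⟨w, rfl⟩ := exists_val t
  have hf : letter f = (one : WithOne (IG S)) := by
    refine letter_eq_of_val_eq_identity ho (u := u) (w := w) ?_
    rw [hst, val_append, val_cons, ← mul_assoc]
    rfl
  rw [hf] at hg
  exact hg (ho g).1 (ho g).2

theorem greenR_iff {T : Type*} [Semigroup T] {a b : T} :
    GreenR a b ↔ ∃ s t : WithOne T, (b : WithOne T) = a * s ∧ (a : WithOne T) = b * t := by
  constructor
  · rintro (rfl | ⟨x, y, rfl, h⟩)
    · exact ⟨1, 1, by simp, by simp⟩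
    · exact ⟨x, y, by simp, by rw [← WithOne.coe_mul, h]⟩
  · rintro ⟨s, t, h, h'⟩
    rcases eq_one_or_coe s with rfl | ⟨s, rfl⟩
    · exact Or.inl (by simpa using h.symm)
    · rcases eq_one_or_coe t with rfl | ⟨t, rfl⟩
      · exact Or.inl (by simpa using h')
      · rw [← WithOne.coe_mul, WithOne.coe_inj] at h h'
        exact Or.inr ⟨s, t, h.symm, h'.symm⟩

theorem greenL_iff {T : Type*} [Semigroup T] {a b : T} :
    GreenL a b ↔ ∃ s t : WithOne T, (b : WithOne T) = s * a ∧ (a : WithOne T) = t * b := by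
  constructor
  · rintro (rfl | ⟨x, y, rfl, h⟩)
    · exact ⟨1, 1, by simp, by simp⟩
    · exact ⟨x, y, by simp, by rw [← WithOne.coe_mul, h]⟩
  · rintro ⟨s, t, h, h'⟩
    rcases eq_one_or_coe s with rfl | ⟨s, rfl⟩
    · exact Or.inl (by simpa using h.symm)
    · rcases eq_one_or_coe t with rfl | ⟨t, rfl⟩
      · exact Or.inl (by simpa using h')
      · rw [← WithOne.coe_mul, WithOne.coe_inj] at h h'
        exact Or.inr ⟨s, t, h.symm, h'.symm⟩

/-- The `𝓗`-class of an element of a monoid. -/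
def hClass {M : Type*} [Monoid M] (e : M) : Set M :=
  {x | (∃ s t, x = e * s ∧ e = x * t) ∧ ∃ s t, x = s * e ∧ e = t * x}

theorem finite_hClass (hfin : ∀ ε : IG S, ε * ε = ε → ¬ IsMaxRegDClass ε →
      Set.Finite {x : IG S | GreenR ε x ∧ GreenL ε x}) {e : IdemE S} (h : ¬ IsTop (letter e)) :
    (hClass (letter e)).Finite := by
  refine (Set.Finite.image (α := IG S) (fun x => (x : WithOne (IG S)))
    (hfin (igBar (FreeSemigroup.of e)) (WithOne.coe_inj.1 (letter_mul_self e))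
      (not_isMaxRegDClass h))).subset ?_
  rintro x ⟨hR, hL⟩
  have hx : x ≠ 1 := by
    rintro rfl
    obtain ⟨s, t, hs, -⟩ := hR
    obtain ⟨l, rfl⟩ := exists_val s
    rw [← val_cons] at hs
    exact val_ne_one (by simp) hs.symm
  obtain ⟨x, rfl⟩ := WithOne.ne_one_iff_exists.1 hx
  exact ⟨x, ⟨greenR_iff.2 hR, greenL_iff.2 hL⟩, rfl⟩

theorem exists_letter_of_left_factor {e f : IdemE S} {x : WithOne (IG S)}
    (h : x * letter f * letter e = letter e) :
    ∃ (b : IdemE S) (s t : WithOne (IG S)),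
      letter b = letter f * letter e * s ∧ letter f * letter e = letter b * t := by
  have h' := congrArg toS h
  simp only [map_mul, toS_letter] at h'
  generalize toS x = x' at h'
  obtain ⟨k, hk⟩ : ∃ k : S,
      (k : WithOne S) = ((e : S) : WithOne S) * x' * ((f : S) : WithOne S) := by
    refine WithOne.ne_one_iff_exists.1 ?_
    rcases eq_one_or_coe x' with rfl | ⟨x', rfl⟩
    · rw [mul_one, ← WithOne.coe_mul]; exact WithOne.coe_ne_one
    · rw [← WithOne.coe_mul, ← WithOne.coe_mul]; exact WithOne.coe_ne_one
  have hee : ((e : S) : WithOne S) * ((e : S) : WithOne S) = ((e : S) : WithOne S) := by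
    rw [← WithOne.coe_mul, e.2]
  have hff : ((f : S) : WithOne S) * ((f : S) : WithOne S) = ((f : S) : WithOne S) := by
    rw [← WithOne.coe_mul, f.2]
  have hke : k * (e : S) = e := eq_of_mul_eq (by
    rw [hk, mul_assoc, mul_assoc, ← mul_assoc x', h', hee])
  have hek : (e : S) * k = k := eq_of_mul_eq (by rw [hk, ← mul_assoc, ← mul_assoc, hee])
  have hkf : k * (f : S) = k := eq_of_mul_eq (by rw [hk, mul_assoc, hff])
  have hkk : k * k = k := by rw [← hek, ← mul_assoc, mul_assoc _ k, hke, e.2]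
  have hb : ((f : S) * k) * ((f : S) * k) = (f : S) * k := by
    rw [mul_assoc, ← mul_assoc k, hkf, hkk]
  have hfk : letter f * letter (⟨k, hkk⟩ : IdemE S) = letter ⟨_, hb⟩ :=
    letter_mul (Or.inr (Or.inr (Or.inr hkf))) rfl
  refine ⟨⟨_, hb⟩, letter ⟨k, hkk⟩, letter e, ?_, ?_⟩
  · rw [mul_assoc, letter_mul_eq_right (x := e) (y := ⟨k, hkk⟩) hek, hfk]
  · rw [← hfk, mul_assoc, letter_mul_eq_right (x := ⟨k, hkk⟩) (y := e) hke]

theorem exists_letter_of_right_factor {e f : IdemE S} {y : WithOne (IG S)}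
    (h : letter e * (letter f * y) = letter e) :
    ∃ (c : IdemE S) (s t : WithOne (IG S)),
      letter c = s * (letter e * letter f) ∧ letter e * letter f = t * letter c := by
  have h' := congrArg toS h
  simp only [map_mul, toS_letter] at h'
  generalize toS y = y' at h'
  obtain ⟨k, hk⟩ : ∃ k : S,
      (k : WithOne S) = ((f : S) : WithOne S) * (y' * ((e : S) : WithOne S)) := by
    refine WithOne.ne_one_iff_exists.1 ?_
    rcases eq_one_or_coe y' with rfl | ⟨y', rfl⟩
    · rw [one_mul, ← WithOne.coe_mul]; exact WithOne.coe_ne_one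
    · rw [← WithOne.coe_mul, ← WithOne.coe_mul]; exact WithOne.coe_ne_one
  have hee : ((e : S) : WithOne S) * ((e : S) : WithOne S) = ((e : S) : WithOne S) := by
    rw [← WithOne.coe_mul, e.2]
  have hff : ((f : S) : WithOne S) * ((f : S) : WithOne S) = ((f : S) : WithOne S) := by
    rw [← WithOne.coe_mul, f.2]
  have hek : (e : S) * k = e := eq_of_mul_eq (by
    rw [hk, ← mul_assoc, ← mul_assoc, mul_assoc _ _ y', h', hee])
  have hke : k * (e : S) = k := eq_of_mul_eq (by rw [hk, mul_assoc, mul_assoc, hee])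
  have hfk : (f : S) * k = k := eq_of_mul_eq (by rw [hk, ← mul_assoc, hff])
  have hkk : k * k = k := by rw [← hke, mul_assoc, ← mul_assoc (e : S), hek, e.2]
  have hb : (k * (f : S)) * (k * (f : S)) = k * (f : S) := by
    rw [mul_assoc, ← mul_assoc (f : S), hfk, ← mul_assoc, hkk]
  have hkf : letter (⟨k, hkk⟩ : IdemE S) * letter f = letter ⟨_, hb⟩ :=
    letter_mul (Or.inr (Or.inr (Or.inl hfk))) rfl
  refine ⟨⟨_, hb⟩, letter ⟨k, hkk⟩, letter e, ?_, ?_⟩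
  · rw [← mul_assoc, letter_mul_eq_left (x := ⟨k, hkk⟩) (y := e) hke, hkf]
  · rw [← hkf, ← mul_assoc, letter_mul_eq_left (x := e) (y := ⟨k, hkk⟩) hek]

theorem exists_letter_greenR {e : IdemE S} (u : List (IdemE S)) {X : WithOne (IG S)}
    (h : X * val u * letter e = letter e) :
    ∃ (b : IdemE S) (s t : WithOne (IG S)),
      letter b = val u * letter e * s ∧ val u * letter e = letter b * t := by
  induction u generalizing X with
  | nil => exact ⟨e, 1, 1, by simp, by simp⟩
  | cons f u ih =>
    rw [val_cons] at h ⊢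
    obtain ⟨b, s, t, hb, ht⟩ := ih (X := X * letter f) (by simpa only [mul_assoc] using h)
    have hx : val u * X * letter f * letter b = letter b := by
      rw [hb]
      calc _ = val u * (X * (letter f * val u) * letter e) * s := by simp only [mul_assoc]
        _ = _ := by rw [h]
    obtain ⟨b', s', t', hb', ht'⟩ := exists_letter_of_left_factor hx
    refine ⟨b', s * s', t' * t, ?_, ?_⟩
    · rw [hb', hb]; simp only [mul_assoc]
    · rw [mul_assoc, ht, ← mul_assoc, ht', mul_assoc]

theorem exists_letter_greenL {e : IdemE S} (w : List (IdemE S)) {Y : WithOne (IG S)}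
    (h : letter e * val w * Y = letter e) :
    ∃ (c : IdemE S) (s t : WithOne (IG S)),
      letter c = s * (letter e * val w) ∧ letter e * val w = t * letter c := by
  induction w using List.reverseRecOn generalizing Y with
  | nil => exact ⟨e, 1, 1, by simp, by simp⟩
  | append_singleton w f ih =>
    simp only [val_append, val_cons, val_nil, mul_one] at h ⊢
    obtain ⟨c, s, t, hc, ht⟩ := ih (Y := letter f * Y) (by simpa only [mul_assoc] using h)
    have hx : letter c * (letter f * (Y * val w)) = letter c := by
      rw [hc]
      calc _ = s * ((letter e * (val w * letter f) * Y) * val w) := by simp only [mul_assoc]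
        _ = _ := by rw [h]
    obtain ⟨c', s', t', hc', ht'⟩ := exists_letter_of_right_factor hx
    refine ⟨c', s' * s, t * t', ?_, ?_⟩
    · rw [hc', hc]; simp only [mul_assoc]
    · rw [← mul_assoc, ht, mul_assoc, ht', mul_assoc]

/-- Elements `p * E * q` with `p * E` in the `𝓛`-class of `E` and the `𝓡`-class of `b`, and with
`E * q` in the `𝓡`-class of `E` and the `𝓛`-class of `c`. -/
def sandwichClass {M : Type*} [Monoid M] (E b c : M) : Set M :=
  {x | ∃ p q X Y s t s' t', x = p * E * q ∧ X * (p * E) = E ∧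
    E * q * Y = E ∧ b = p * E * s ∧ p * E = b * t ∧
    c = s' * (E * q) ∧ E * q = t' * c}

theorem finite_sandwichClass {M : Type*} [Monoid M] {E : M} (hEE : E * E = E)
    (h : (hClass E).Finite) (b c : M) :
    (sandwichClass E b c).Finite := by
  rcases (sandwichClass E b c).eq_empty_or_nonempty with h0 | ⟨x₀, hx₀⟩
  · rw [h0]; exact Set.finite_empty
  obtain ⟨p₀, q₀, X₀, Y₀, s₀, t₀, s₀', t₀', -, hX₀, hY₀, hb₀, hp₀, hc₀, hq₀⟩ := hx₀
  have hleft : p₀ * X₀ * b = b := by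
    rw [hb₀]
    calc _ = p₀ * (X₀ * (p₀ * E)) * s₀ := by simp only [mul_assoc]
      _ = _ := by rw [hX₀]
  have hright : c * (Y₀ * q₀) = c := by
    rw [hc₀]
    calc _ = s₀' * ((E * q₀ * Y₀) * q₀) := by simp only [mul_assoc]
      _ = _ := by rw [hY₀]
  refine Set.Finite.of_finite_image (f := fun x => X₀ * x * Y₀) (h.subset ?_) ?_
  · rintro _ ⟨_, ⟨p, q, X, Y, s, t, s', t', rfl, hX, hY, hb, hp, hc, hq⟩, rfl⟩
    have h₁ : X₀ * (p * E) = E * (s₀ * t) := by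
      rw [hp, hb₀, ← mul_assoc, ← mul_assoc, hX₀, mul_assoc]
    have h₂ : X₀ * (p * E) * (s * t₀) = E := by
      calc _ = X₀ * ((p * E * s) * t₀) := by simp only [mul_assoc]
        _ = E := by rw [← hb, ← hp₀, hX₀]
    have h₃ : E * q * Y₀ = t' * s₀' * E := by
      rw [hq, hc₀]
      calc _ = t' * s₀' * (E * q₀ * Y₀) := by simp only [mul_assoc]
        _ = _ := by rw [hY₀]
    have h₄ : t₀' * s' * (E * q * Y₀) = E := by
      calc _ = t₀' * (s' * (E * q)) * Y₀ := by simp only [mul_assoc]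
        _ = _ := by rw [← hc, ← hq₀, hY₀]
    have h₅ : X₀ * (p * E * q) * Y₀ = X₀ * (p * E) * (E * q * Y₀) := by
      calc _ = X₀ * (p * (E * E) * q) * Y₀ := by rw [hEE]
        _ = _ := by simp only [mul_assoc]
    have h₆ : E * q * Y₀ * (q₀ * Y) = E := by
      calc _ = t' * (c * (Y₀ * q₀)) * Y := by rw [hq]; simp only [mul_assoc]
        _ = E := by rw [hright, ← hq, hY]
    have h₇ : X * p₀ * (X₀ * (p * E)) = E := by
      calc _ = X * (p₀ * X₀ * b) * t := by rw [hp]; simp only [mul_assoc]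
        _ = E := by rw [hleft, mul_assoc, ← hp, hX]
    have h₈ : E * (X₀ * (p * E)) = X₀ * (p * E) := by rw [h₁, ← mul_assoc, hEE]
    have h₉ : (E * q * Y₀) * E = E * q * Y₀ := by rw [h₃, mul_assoc, hEE]
    have h₁₀ : X₀ * (p * E) * E = X₀ * (p * E) := by rw [mul_assoc, mul_assoc, hEE]
    have h₁₁ : E * (E * q * Y₀) = E * q * Y₀ := by rw [← mul_assoc, ← mul_assoc, hEE]
    dsimp only
    rw [h₅]
    set α := X₀ * (p * E)
    set β := E * q * Y₀
    refine ⟨⟨s₀ * t * β, q₀ * Y * (s * t₀), ?_, ?_⟩, α * (t' * s₀'), t₀' * s' * (X * p₀), ?_, ?_⟩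
    · rw [h₁]; simp only [mul_assoc]
    · rw [mul_assoc α, ← mul_assoc β, h₆, ← mul_assoc α, h₁₀, h₂]
    · rw [h₃]; simp only [mul_assoc]
    · rw [mul_assoc (t₀' * s'), ← mul_assoc (X * p₀), h₇, h₁₁, h₄]
  · have hinj : ∀ x ∈ sandwichClass E b c, p₀ * (X₀ * x * Y₀) * q₀ = x := by
      rintro _ ⟨p, q, X, Y, s, t, s', t', rfl, hX, hY, hb, hp, hc, hq⟩
      calc p₀ * (X₀ * (p * E * q) * Y₀) * q₀
          = p₀ * (X₀ * (p * (E * E) * q) * Y₀) * q₀ := by rw [hEE]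
        _ = p₀ * X₀ * (p * E) * (E * q) * (Y₀ * q₀) := by simp only [mul_assoc]
        _ = (p₀ * X₀ * b) * t * (t' * (c * (Y₀ * q₀))) := by
            rw [hp, hq]; simp only [mul_assoc]
        _ = p * (E * E) * q := by
            rw [hleft, hright, ← hp, ← hq]; simp only [mul_assoc]
        _ = p * E * q := by rw [hEE]
    intro x hx y hy hxy
    rw [← hinj x hx, ← hinj y hy]
    exact congrArg (fun z => p₀ * z * q₀) hxy

/-- Values of seeded words outside the top classes. -/
def lowClass (S : Type*) [Semigroup S] : Set (WithOne (IG S)) :=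
  {x | (∃ P, Seeded P ∧ val P = x) ∧ ¬ IsTop x}

theorem finite_lowClass [Finite (IdemE S)]
    (hfin : ∀ e : IdemE S, ¬ IsTop (letter e) → (hClass (letter e)).Finite) :
    (lowClass S).Finite := by
  have : (⋃ e : {e : IdemE S // ¬ IsTop (letter e)}, ⋃ b : IdemE S, ⋃ c : IdemE S,
      sandwichClass (letter e.1) (letter b) (letter c)).Finite :=
    Set.finite_iUnion fun e => Set.finite_iUnion fun b => Set.finite_iUnion fun c =>
      finite_sandwichClass (letter_mul_self e.1) (hfin e.1 e.2) _ _
  refine this.subset ?_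
  rintro _ ⟨⟨_, ⟨u, e, w, X, Y, rfl, hu, hw⟩, rfl⟩, htop⟩
  obtain ⟨b, s, t, hb, ht⟩ := exists_letter_greenR u hu
  obtain ⟨c, s', t', hc, ht'⟩ := exists_letter_greenL w hw
  have he : ¬ IsTop (letter e) := by
    refine fun h => htop (h.of_dvd ⟨X, Y, ?_⟩ ⟨val u, val w, by simp [mul_assoc]⟩)
    rw [val_append, val_cons, ← mul_assoc, ← mul_assoc, hu, hw]
  simp only [Set.mem_iUnion]
  exact ⟨⟨e, he⟩, b, c, val u, val w, X, Y, s, t, s', t', by simp [mul_assoc],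
    by rw [← mul_assoc, hu], hw, hb, ht, hc, ht'⟩

theorem Seeded.exists_letter_left {P : List (IdemE S)} (h : Seeded P) :
    ∃ (b : IdemE S) (s t : WithOne (IG S)), letter b = val P * s ∧ val P = letter b * t := by
  obtain ⟨u, e, w, X, Y, rfl, hu, hw⟩ := h
  obtain ⟨b, s, t, hb, ht⟩ := exists_letter_greenR u hu
  refine ⟨b, Y * s, t * val w, ?_, ?_⟩
  · rw [hb, val_append, val_cons, ← mul_assoc, mul_assoc (val u) _ Y, hw]
  · rw [val_append, val_cons, ← mul_assoc, ht, mul_assoc]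

theorem Seeded.exists_letter_right {P : List (IdemE S)} (h : Seeded P) :
    ∃ (c : IdemE S) (s t : WithOne (IG S)), letter c = s * val P ∧ val P = t * letter c := by
  obtain ⟨u, e, w, X, Y, rfl, hu, hw⟩ := h
  obtain ⟨c, s, t, hc, ht⟩ := exists_letter_greenL w hw
  refine ⟨c, s * X, val u * t, ?_, ?_⟩
  · rw [hc, val_append, val_cons, mul_assoc s, ← mul_assoc (val u), ← mul_assoc X,
      ← mul_assoc X, hu]
  · rw [val_append, val_cons, ht, mul_assoc]

theorem letter_mul_val {a : IdemE S} (ha : ∀ g : IdemE S, letter a * letter g = letter g ∧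
    letter g * letter a = letter g) {P : List (IdemE S)} (hP : P ≠ []) :
    letter a * val P = val P := by
  cases P with
  | nil => exact absurd rfl hP
  | cons f P => rw [val_cons, ← mul_assoc, (ha f).1]

theorem val_mul_letter {a : IdemE S} (ha : ∀ g : IdemE S, letter a * letter g = letter g ∧
    letter g * letter a = letter g) {P : List (IdemE S)} (hP : P ≠ []) :
    val P * letter a = val P := by
  rcases List.eq_nil_or_concat P with rfl | ⟨P, f, rfl⟩
  · exact absurd rfl hP
  · simp [mul_assoc, (ha f).2]

theorem Seeded.shift_cases [Finite (IdemE S)] {P Q P' Q' : List (IdemE S)} (hP : Seeded P)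
    (hQ : Seeded Q) (hP' : Seeded P') (hQ' : Seeded Q')
    (h : Shift (val P) (val Q) (val P') (val Q')) :
    (val P = val P' ∧ val Q = val Q') ∨ (Seeded (P ++ Q) ∧ Seeded (P' ++ Q')) ∨
      (val P ∈ lowClass S ∧ val Q ∈ lowClass S ∧ val P' ∈ lowClass S ∧ val Q' ∈ lowClass S) := by
  obtain ⟨a, hp, hq, ⟨s, hs⟩, t, ht⟩ := h
  have haa := letter_mul_self a
  have htriv : (∀ g : IdemE S, letter a * letter g = letter g ∧ letter g * letter a = letter g) →
      val P = val P' ∧ val Q = val Q' := fun ha =>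
    ⟨by rw [hp, val_mul_letter ha hP'.ne_nil], by rw [hq, letter_mul_val ha hQ.ne_nil]⟩
  have hprod : val P' * val Q' = val P * val Q := by rw [hq, hp, mul_assoc]
  by_cases hpt : IsTop (val P)
  · rcases hpt a ⟨val P', 1, by rw [hp, mul_one]⟩ with ⟨s₀, t₀, ha⟩ | ha
    · obtain ⟨c, A, B, hA, hB⟩ := hP.exists_letter_right
      have hpa : val P * letter a = val P := by rw [hp, mul_assoc, haa]
      have hca : letter c * letter a = letter c := by rw [hA, mul_assoc, hpa]
      have hca' := mul_eq_of_letter hca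
      have hh : ((a : S) * c) * ((a : S) * c) = (a : S) * c := by
        rw [mul_assoc, ← mul_assoc (c : S), hca', c.2]
      have hac : letter a * letter c = letter (⟨_, hh⟩ : IdemE S) :=
        letter_mul (Or.inr (Or.inr (Or.inr hca'))) rfl
      have key : (⟨_, hh⟩ : IdemE S) = a := by
        refine eq_of_letter_factor (X := s₀ * B * letter c) (Y := t₀) ?_ ?_ ?_
        · rw [mul_assoc, hca']
        · rw [← mul_assoc, a.2]
        · rw [← hac]
          calc letter a = s₀ * B * letter c * t₀ := by rw [ha, hB]; simp only [mul_assoc]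
            _ = s₀ * B * (letter c * letter a * letter c) * t₀ := by
              rw [hca, letter_mul_self, mul_assoc (s₀ * B)]
            _ = _ := by
              simp only [mul_assoc]
      have hac' : letter a * letter c = letter a := by rw [hac, key]
      have hmerge : letter a * A * (val P * val Q) = val Q' := by
        rw [← mul_assoc, mul_assoc (letter a), ← hA, hac', hq]
      refine Or.inr (Or.inl ⟨hQ.append_left P (X := t * (letter a * A)) ?_,
        hQ'.append_left P' (X := letter a * A) ?_⟩)
      · rw [mul_assoc, mul_assoc, hmerge, ← ht]
      · rw [mul_assoc, hprod, hmerge]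
    · exact Or.inl (htriv ha)
  by_cases hqt : IsTop (val Q')
  · rcases hqt a ⟨1, val Q, by rw [hq, one_mul]⟩ with ⟨s₀, t₀, ha⟩ | ha
    · obtain ⟨b, A, B, hA, hB⟩ := hQ'.exists_letter_left
      have hqa : letter a * val Q' = val Q' := by rw [hq, ← mul_assoc, haa]
      have hab : letter a * letter b = letter b := by rw [hA, ← mul_assoc, hqa]
      have hab' := mul_eq_of_letter hab
      have hh : ((b : S) * a) * ((b : S) * a) = (b : S) * a := by
        rw [mul_assoc, ← mul_assoc (a : S), hab', ← mul_assoc, b.2]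
      have hba : letter b * letter a = letter (⟨_, hh⟩ : IdemE S) :=
        letter_mul (Or.inr (Or.inr (Or.inl hab'))) rfl
      have key : (⟨_, hh⟩ : IdemE S) = a := by
        refine eq_of_letter_factor (X := s₀) (Y := letter b * B * t₀) ?_ ?_ ?_
        · rw [mul_assoc, a.2]
        · rw [← mul_assoc, hab']
        · rw [← hba]
          calc letter a = s₀ * letter b * B * t₀ := by rw [ha, hB]; simp only [mul_assoc]
            _ = s₀ * (letter b * (letter a * letter b)) * B * t₀ := by
              rw [hab, letter_mul_self]
            _ = _ := by simp only [mul_assoc]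
      have hba' : letter b * letter a = letter a := by rw [hba, key]
      have hmerge : val P * val Q * (A * letter a) = val P := by
        rw [← hprod, mul_assoc, ← mul_assoc (val Q'), ← hA, hba', hp]
      refine Or.inr (Or.inl ⟨hP.append_right Q (Y := A * letter a) hmerge,
        hP'.append_right Q' (Y := A * letter a * s) ?_⟩)
      rw [hprod, ← mul_assoc, hmerge, ← hs]
    · exact Or.inl (htriv ha)
  · refine Or.inr (Or.inr ⟨⟨⟨P, hP, rfl⟩, hpt⟩, ⟨⟨Q, hQ, rfl⟩, fun h => hqt ?_⟩,
      ⟨⟨P', hP', rfl⟩, fun h => hpt ?_⟩, ⟨Q', hQ', rfl⟩, hqt⟩)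
    · exact h.of_dvd ⟨t, 1, by rw [mul_one, ht]⟩ ⟨letter a, 1, by rw [mul_one, hq]⟩
    · exact h.of_dvd ⟨1, s, by rw [one_mul, hs]⟩ ⟨1, letter a, by rw [one_mul, hp]⟩

/-- Two words can be joined by a derivation through words of length at most `n`. -/
def Conn (n : ℕ) : List (IdemE S) → List (IdemE S) → Prop :=
  Relation.ReflTransGen fun a b => (Step a b ∨ Step b a) ∧ a.length ≤ n ∧ b.length ≤ n

theorem Conn.symm {n : ℕ} {l l' : List (IdemE S)} (h : Conn n l l') : Conn n l' l :=
  have : Std.Symm fun a b : List (IdemE S) =>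
      (Step a b ∨ Step b a) ∧ a.length ≤ n ∧ b.length ≤ n :=
    ⟨fun _ _ h => ⟨h.1.symm, h.2.2, h.2.1⟩⟩
  Relation.ReflTransGen.stdSymm.symm _ _ h

theorem Conn.trans {n : ℕ} {a b c : List (IdemE S)} (h : Conn n a b) (h' : Conn n b c) :
    Conn n a c :=
  Relation.ReflTransGen.trans h h'

theorem Conn.mono {m n : ℕ} (hmn : m ≤ n) {l l' : List (IdemE S)} (h : Conn m l l') :
    Conn n l l' :=
  Relation.ReflTransGen.mono (fun _ _ h => ⟨h.1, h.2.1.trans hmn, h.2.2.trans hmn⟩) _ _ h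

theorem Conn.append {n m : ℕ} {l l' : List (IdemE S)} (h : Conn n l l') (c d : List (IdemE S))
    (hm : n + c.length + d.length ≤ m) : Conn m (c ++ l ++ d) (c ++ l' ++ d) := by
  refine Relation.ReflTransGen.lift (fun l => c ++ l ++ d) (fun a b hab => ?_) _ _ h
  refine ⟨hab.1.imp (fun h => h.append c d) (fun h => h.append c d), ?_, ?_⟩
  · have := hab.2.1; simp only [List.length_append]; omega
  · have := hab.2.2; simp only [List.length_append]; omega

theorem Conn.val_eq {n : ℕ} {l l' : List (IdemE S)} (h : Conn n l l') : val l = val l' := by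
  induction h with
  | refl => rfl
  | tail _ h ih => exact ih.trans (h.1.elim Step.val_eq fun h => h.val_eq.symm)

theorem exists_conn_of_val_eq {l l' : List (IdemE S)} (h : val l = val l') : ∃ n, Conn n l l' := by
  replace h := val_eq_iff.1 h
  induction h with
  | rel a b h =>
    exact ⟨max a.length b.length, .single ⟨Or.inl h, le_max_left .., le_max_right ..⟩⟩
  | refl => exact ⟨0, .refl⟩
  | symm _ _ _ ih => exact ih.imp fun _ h => h.symm
  | trans _ _ _ _ _ ih₁ ih₂ =>
    obtain ⟨n, hn⟩ := ih₁
    obtain ⟨m, hm⟩ := ih₂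
    exact ⟨max n m, (hn.mono (le_max_left ..)).trans (hm.mono (le_max_right ..))⟩

theorem exists_conn_bound [Finite (IdemE S)] (n : ℕ) : ∃ K, ∀ l l' : List (IdemE S),
    l.length ≤ n → l'.length ≤ n → val l = val l' → Conn K l l' := by
  have hs : {l : List (IdemE S) | l.length ≤ n}.Finite := List.finite_length_le _ n
  have : ∀ᶠ K in Filter.atTop, ∀ l ∈ {l : List (IdemE S) | l.length ≤ n},
      ∀ l' ∈ {l : List (IdemE S) | l.length ≤ n}, val l = val l' → Conn K l l' := by
    refine (Filter.eventually_all_finite hs).2 fun l _ => (Filter.eventually_all_finite hs).2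
      fun l' _ => ?_
    by_cases h : val l = val l'
    · obtain ⟨K, hK⟩ := exists_conn_of_val_eq h
      exact Filter.eventually_atTop.2 ⟨K, fun m hm _ => hK.mono hm⟩
    · exact .of_forall fun _ h' => absurd h' h
  obtain ⟨K, hK⟩ := this.exists
  exact ⟨K, fun l l' hl hl' => hK l hl l' hl'⟩

theorem exists_shortest (x : WithOne (IG S)) :
    ∃ l : List (IdemE S), val l = x ∧ ∀ l', val l' = x → l.length ≤ l'.length := by
  have := exists_val x
  obtain ⟨l, hl, hmin⟩ := WellFounded.has_min (measure (List.length : List (IdemE S) → ℕ)).wf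
    {l | val l = x} this
  exact ⟨l, hl, fun l' hl' => not_lt.1 (hmin l' hl')⟩

/-- A shortest word with a given value. -/
noncomputable def rep (x : WithOne (IG S)) : List (IdemE S) := (exists_shortest x).choose

@[simp] theorem val_rep (x : WithOne (IG S)) : val (rep x) = x := (exists_shortest x).choose_spec.1

theorem length_rep_le (l : List (IdemE S)) : (rep (val l)).length ≤ l.length :=
  (exists_shortest (val l)).choose_spec.2 l rfl

theorem mem_lowClass {u w : List (IdemE S)} {e : IdemE S} {X Y : WithOne (IG S)}
    (he : ¬ IsTop (letter e)) (hu : X * val u * letter e = letter e)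
    (hw : letter e * val w * Y = letter e) : val (u ++ e :: w) ∈ lowClass S := by
  refine ⟨⟨_, ⟨u, e, w, X, Y, rfl, hu, hw⟩, rfl⟩, fun h => he (h.of_dvd
    ⟨val u, val w, by simp [mul_assoc]⟩ ⟨X, Y, ?_⟩)⟩
  rw [val_append, val_cons, ← mul_assoc, ← mul_assoc, hu, hw]

theorem exists_low_bounds [Finite (IdemE S)] (hN : (lowClass S).Finite) :
    ∃ C K, (∀ x ∈ lowClass S, (rep x).length ≤ C) ∧
      (∀ P : List (IdemE S), Seeded P → val P ∈ lowClass S →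
        Conn (P.length + K) P (rep (val P))) ∧
      ∀ l l' : List (IdemE S), l.length ≤ 2 * C → l'.length ≤ 2 * C → val l = val l' →
        Conn K l l' := by
  obtain ⟨C, hC1, hC⟩ : ∃ C, 1 ≤ C ∧ ∀ x ∈ lowClass S, (rep x).length ≤ C := by
    obtain ⟨C, hC⟩ := (hN.image fun x => (rep x).length).bddAbove
    exact ⟨max 1 C, le_max_left .., fun x hx => (hC ⟨x, hx, rfl⟩).trans (le_max_right ..)⟩
  obtain ⟨K, hK⟩ := exists_conn_bound (S := S) (2 * C)
  refine ⟨C, K, hC, ?_, hK⟩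
  rintro _ ⟨u, e, w, X, Y, rfl, hu, hw⟩ hlow
  have he : ¬ IsTop (letter e) := by
    refine fun h => hlow.2 (h.of_dvd ⟨X, Y, ?_⟩ ⟨val u, val w, by simp [mul_assoc]⟩)
    rw [val_append, val_cons, ← mul_assoc, ← mul_assoc, hu, hw]
  have right : ∀ (w : List (IdemE S)) (Y : WithOne (IG S)), letter e * val w * Y = letter e →
      Conn (w.length + 1 + K) (e :: w) (rep (val (e :: w))) := by
    intro w
    induction w using List.reverseRecOn with
    | nil =>
      intro Y _
      refine (hK _ _ ?_ ?_ (val_rep _).symm).mono (by omega)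
      · simp only [List.length_singleton]; omega
      · refine (length_rep_le _).trans ?_
        simp only [List.length_singleton]; omega
    | append_singleton w f ih =>
      intro Y hY
      have hY' : letter e * val w * (letter f * Y) = letter e := by
        simpa [mul_assoc] using hY
      have h₁ := (ih _ hY').append [] [f] (m := (w ++ [f]).length + 1 + K) (by simp)
      have hl := mem_lowClass (u := []) (X := 1) he (by simp) hY'
      have hl' := mem_lowClass (u := []) (X := 1) he (by simp) hY
      have h₂ : Conn K (rep (val (e :: w)) ++ [f]) (rep (val (e :: (w ++ [f])))) := by
        refine hK _ _ ?_ ?_ (by simp [mul_assoc])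
        · have := hC _ hl
          simp only [List.length_append, List.length_singleton, List.nil_append] at this ⊢
          omega
        · have := hC _ hl'
          simp only [List.nil_append] at this
          omega
      exact Conn.trans (by simpa using h₁) (h₂.mono (by omega))
  have left : ∀ (u : List (IdemE S)) (X : WithOne (IG S)), X * val u * letter e = letter e →
      Conn (u.length + w.length + 1 + K) (u ++ e :: w) (rep (val (u ++ e :: w))) := by
    intro u
    induction u with
    | nil =>
      intro X _
      exact (right w Y hw).mono (by simp)
    | cons f u ih =>
      intro X hX
      have hX' : X * letter f * val u * letter e = letter e := by
        simpa [mul_assoc] using hX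
      have h₁ := (ih _ hX').append [f] [] (m := (f :: u).length + w.length + 1 + K)
        (by simp)
      have hl := mem_lowClass he hX' hw
      have hl' := mem_lowClass he hX hw
      have h₂ : Conn K (f :: rep (val (u ++ e :: w))) (rep (val (f :: (u ++ e :: w)))) := by
        refine hK _ _ ?_ ?_ (by simp)
        · have := hC _ hl
          simp only [List.length_cons]
          omega
        · have := hC _ hl'
          rw [List.cons_append] at this
          omega
      exact Conn.trans (by simpa using h₁) (h₂.mono (by omega))
  refine (left u X hu).mono ?_
  simp only [List.length_append, List.length_cons]
  omega

/-- Deletion of a letter absorbed by one of its neighbours. -/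
def Absorb (l l' : List (IdemE S)) : Prop :=
  ∃ (a b : List (IdemE S)) (x y : IdemE S), l = a ++ x :: y :: b ∧
    ((x : S) * y = x ∧ l' = a ++ x :: b ∨ (x : S) * y = y ∧ l' = a ++ y :: b)

theorem Absorb.step {l l' : List (IdemE S)} (h : Absorb l l') : Step l l' := by
  obtain ⟨a, b, x, y, rfl, ⟨h, rfl⟩ | ⟨h, rfl⟩⟩ := h
  · exact ⟨a, b, x, y, x, Or.inl h, h.symm, rfl, rfl⟩
  · exact ⟨a, b, x, y, y, Or.inr (Or.inl h), h.symm, rfl, rfl⟩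

theorem absorb_left {x y : IdemE S} (h : (x : S) * y = x) (a b : List (IdemE S)) :
    Absorb (a ++ x :: y :: b) (a ++ x :: b) := ⟨a, b, x, y, rfl, Or.inl ⟨h, rfl⟩⟩

theorem absorb_right {x y : IdemE S} (h : (x : S) * y = y) (a b : List (IdemE S)) :
    Absorb (a ++ x :: y :: b) (a ++ y :: b) := ⟨a, b, x, y, rfl, Or.inr ⟨h, rfl⟩⟩

theorem Absorb.diamond {l l₁ l₂ : List (IdemE S)} (h₁ : Absorb l l₁) (h₂ : Absorb l l₂) :
    l₁ = l₂ ∨ ∃ d, Absorb l₁ d ∧ Absorb l₂ d := by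
  obtain ⟨a, b, x, y, rfl, h₁⟩ := h₁
  obtain ⟨a', b', x', y', hl, h₂⟩ := h₂
  have main : ∀ (c a b b' l₁ l₂ : List (IdemE S)) (x y x' y' : IdemE S),
      (x : S) * y = x ∧ l₁ = a ++ x :: b ∨ (x : S) * y = y ∧ l₁ = a ++ y :: b →
      (x' : S) * y' = x' ∧ l₂ = a ++ c ++ x' :: b' ∨ (x' : S) * y' = y' ∧ l₂ = a ++ c ++ y' :: b' →
      x :: y :: b = c ++ x' :: y' :: b' → l₁ = l₂ ∨ ∃ d, Absorb l₁ d ∧ Absorb l₂ d := by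
    intro c a b b' l₁ l₂ x y x' y' h₁ h₂ hl
    rcases c with _ | ⟨c₁, _ | ⟨c₂, c⟩⟩
    · obtain ⟨rfl, rfl, rfl⟩ : x = x' ∧ y = y' ∧ b = b' := by simpa using hl
      rcases h₁ with ⟨h₁, rfl⟩ | ⟨h₁, rfl⟩ <;> rcases h₂ with ⟨h₂, rfl⟩ | ⟨h₂, rfl⟩
      · simp
      · left; simp [show x = y from Subtype.ext (h₁.symm.trans h₂)]
      · left; simp [show x = y from Subtype.ext (h₂.symm.trans h₁)]
      · simp
    · obtain ⟨rfl, rfl, rfl⟩ : x = c₁ ∧ y = x' ∧ b = y' :: b' := by simpa using hl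
      rcases h₁ with ⟨h₁, rfl⟩ | ⟨h₁, rfl⟩ <;> rcases h₂ with ⟨h₂, rfl⟩ | ⟨h₂, rfl⟩
      · have h : (x : S) * y' = x := by rw [← h₁, mul_assoc, h₂]
        exact Or.inr ⟨_, absorb_left h a b', by simpa using absorb_left h₁ a b'⟩
      · left; simp
      · exact Or.inr ⟨_, absorb_left h₂ a b', by simpa using absorb_right h₁ a b'⟩
      · have h : (x : S) * y' = y' := by rw [← h₂, ← mul_assoc, h₁]
        exact Or.inr ⟨_, absorb_right h₂ a b', by simpa using absorb_right h a b'⟩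
    · obtain ⟨rfl, rfl, rfl⟩ : x = c₁ ∧ y = c₂ ∧ b = c ++ x' :: y' :: b' := by simpa using hl
      right
      rcases h₁ with ⟨h₁, rfl⟩ | ⟨h₁, rfl⟩ <;> rcases h₂ with ⟨h₂, rfl⟩ | ⟨h₂, rfl⟩
      · exact ⟨_, by simpa using absorb_left h₂ (a ++ x :: c) b',
          by simpa using absorb_left h₁ a (c ++ x' :: b')⟩
      · exact ⟨_, by simpa using absorb_right h₂ (a ++ x :: c) b',
          by simpa using absorb_left h₁ a (c ++ y' :: b')⟩
      · exact ⟨_, by simpa using absorb_left h₂ (a ++ y :: c) b',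
          by simpa using absorb_right h₁ a (c ++ x' :: b')⟩
      · exact ⟨_, by simpa using absorb_right h₂ (a ++ y :: c) b',
          by simpa using absorb_right h₁ a (c ++ y' :: b')⟩
  rcases List.append_eq_append_iff.1 hl with ⟨c, rfl, hc⟩ | ⟨c, rfl, hc⟩
  · exact main c a b b' l₁ l₂ x y x' y' h₁ h₂ hc
  · rcases main c a' b' b l₂ l₁ x' y' x y h₂ h₁ hc with h | ⟨d, h, h'⟩
    · exact Or.inl h.symm
    · exact Or.inr ⟨d, h', h⟩

theorem Step.absorb_of_isTop [Finite (IdemE S)] {l l' : List (IdemE S)} (h : Step l l')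
    (ht : IsTop (val l)) : Absorb l l' := by
  have hv := h.val_eq
  obtain ⟨a, b, x, y, z, hb, hz, rfl, rfl⟩ := h
  have top : ∀ f : IdemE S, f = x ∨ f = y → (∃ s t, letter f = s * letter z * t) ∨
      ∀ g : IdemE S, (f : S) * g = g ∧ (g : S) * f = g := by
    intro f hf
    refine (ht f ?_).imp ?_ fun h g => ⟨mul_eq_of_letter (h g).1, mul_eq_of_letter (h g).2⟩
    · rcases hf with rfl | rfl
      · exact ⟨val a, letter y * val b, by simp [mul_assoc]⟩
      · exact ⟨val a * letter x, val b, by simp [mul_assoc]⟩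
    · rintro ⟨s, t, h⟩
      refine ⟨s * val a, val b * t, ?_⟩
      rw [h, hv]
      simp [mul_assoc]
  have hx : (x : S) * y = x → Absorb (a ++ x :: y :: b) (a ++ z :: b) := fun h => by
    obtain rfl : z = x := Subtype.ext (hz.trans h)
    exact absorb_left h a b
  have hy : (x : S) * y = y → Absorb (a ++ x :: y :: b) (a ++ z :: b) := fun h => by
    obtain rfl : z = y := Subtype.ext (hz.trans h)
    exact absorb_right h a b
  rcases hb with h | h | h | h
  · exact hx h
  · exact hy h
  · rcases top y (Or.inr rfl) with ⟨s, t, hst⟩ | hid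
    · refine hy ?_
      rw [← hz]
      refine congrArg Subtype.val (eq_of_letter_factor (g := y) (h := z) ?_ ?_ hst)
      · rw [hz, mul_assoc, y.2]
      · rw [hz, ← mul_assoc, h]
    · exact hx (hid x).2
  · rcases top x (Or.inl rfl) with ⟨s, t, hst⟩ | hid
    · refine hx ?_
      rw [← hz]
      refine congrArg Subtype.val (eq_of_letter_factor (g := x) (h := z) ?_ ?_ hst)
      · rw [hz, mul_assoc, h]
      · rw [hz, ← mul_assoc, x.2]
    · exact hy (hid y).1

theorem conn_of_absorb {l l' : List (IdemE S)} (h : Relation.ReflTransGen Absorb l l') :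
    Conn l.length l l' := by
  induction h using Relation.ReflTransGen.head_induction_on with
  | refl => exact .refl
  | head h _ ih =>
    have := h.step.length_eq
    exact .head ⟨Or.inl h.step, le_rfl, by omega⟩ (ih.mono (by omega))

theorem conn_of_isTop [Finite (IdemE S)] {l l' : List (IdemE S)} (h : val l = val l')
    (ht : IsTop (val l)) : Conn (max l.length l'.length) l l' := by
  have heq : Equivalence (Relation.Join (Relation.ReflTransGen (Absorb (S := S)))) :=
    Relation.equivalence_join_reflTransGen fun a b c hb hc => by
      rcases hb.diamond hc with rfl | ⟨d, hbd, hcd⟩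
      · exact ⟨b, .refl, .refl⟩
      · exact ⟨d, .single hbd, .single hcd⟩
  have key : Relation.Join (Relation.ReflTransGen Absorb) l l' := by
    replace h := val_eq_iff.1 h
    induction h with
    | rel a b h => exact ⟨b, .single (h.absorb_of_isTop ht), .refl⟩
    | refl => exact heq.refl _
    | symm a b hab ih => exact heq.symm (ih (by rwa [val_eq_of_eqvGen hab]))
    | trans a b c hab hbc ih₁ ih₂ =>
      exact heq.trans (ih₁ ht) (ih₂ (by rwa [← val_eq_of_eqvGen hab]))
  obtain ⟨d, h₁, h₂⟩ := key
  exact ((conn_of_absorb h₁).mono (le_max_left ..)).trans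
    ((conn_of_absorb h₂).mono (le_max_right ..)).symm

/-- The concatenation of shortest representatives of a list of values. -/
noncomputable def reps (vs : List (WithOne (IG S))) : List (IdemE S) := (vs.map rep).flatten

/-- The total length of shortest representatives, each counted at least `C`. -/
noncomputable def weight (C : ℕ) (vs : List (WithOne (IG S))) : ℕ :=
  (vs.map fun x => max (rep x).length C).sum

theorem length_reps_le (C : ℕ) (vs : List (WithOne (IG S))) : (reps vs).length ≤ weight C vs := by
  induction vs with
  | nil => simp [reps, weight]
  | cons x vs ih =>
    simp only [reps, weight, List.map_cons, List.flatten_cons, List.length_append,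
      List.sum_cons] at ih ⊢
    exact Nat.add_le_add (le_max_left ..) ih

theorem weight_le (C : ℕ) (Ps : List (List (IdemE S))) :
    weight C (Ps.map val) ≤ Ps.flatten.length + C * Ps.length := by
  induction Ps with
  | nil => simp [weight]
  | cons P Ps ih =>
    have := length_rep_le P
    simp only [weight, List.map_cons, List.sum_cons, List.flatten_cons, List.length_append,
      List.length_cons, mul_add] at ih ⊢
    have : max (rep (val P)).length C ≤ P.length + C := by omega
    omega

theorem IsFact.move_cases [Finite (IdemE S)] {C K : ℕ}
    (hC : ∀ x ∈ lowClass S, (rep x).length ≤ C)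
    (hK : ∀ l l' : List (IdemE S), l.length ≤ 2 * C → l'.length ≤ 2 * C → val l = val l' →
      Conn K l l')
    {l l' : List (IdemE S)} {Ps Ps' : List (List (IdemE S))} (hf : IsFact l Ps)
    (hf' : IsFact l' Ps') (h : Move Ps Ps') :
    (∃ Qs, IsFact l Qs ∧ Qs.length < Ps.length) ∧ (∃ Qs, IsFact l' Qs ∧ Qs.length < Ps'.length) ∨
      weight C (Ps.map val) = weight C (Ps'.map val) ∧
        Conn (weight C (Ps.map val) + K) (reps (Ps.map val)) (reps (Ps'.map val)) := by
  obtain ⟨A, B, p, q, p', q', rfl, rfl, hs⟩ := h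
  obtain ⟨rfl, hf⟩ := hf
  obtain ⟨rfl, hf'⟩ := hf'
  have merge : ∀ p q : List (IdemE S), Seeded (p ++ q) → (∀ P ∈ A ++ p :: q :: B, Seeded P) →
      ∃ Qs, IsFact (A ++ p :: q :: B).flatten Qs ∧ Qs.length < (A ++ p :: q :: B).length := by
    refine fun p q hpq hf => ⟨A ++ (p ++ q) :: B, ⟨by simp, fun P hP => ?_⟩, by simp⟩
    simp only [List.mem_append, List.mem_cons] at hP hf
    rcases hP with hP | rfl | hP
    · exact hf _ (Or.inl hP)
    · exact hpq
    · exact hf _ (Or.inr (Or.inr (Or.inr hP)))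
  have hval : val (p ++ q) = val (p' ++ q') := by
    obtain ⟨a, h, h', -⟩ := hs
    rw [val_append, val_append, h, h', mul_assoc]
  rcases (hf p (by simp)).shift_cases (hf q (by simp)) (hf' p' (by simp)) (hf' q' (by simp)) hs with
    ⟨h, h'⟩ | ⟨h, h'⟩ | ⟨hp, hq, hp', hq'⟩
  · right
    simp only [List.map_append, List.map_cons, h, h']
    exact ⟨trivial, .refl⟩
  · exact Or.inl ⟨merge p q h hf, merge p' q' h' hf'⟩
  · right
    have hp := hC _ hp
    have hq := hC _ hq
    have hp' := hC _ hp'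
    have hq' := hC _ hq'
    refine ⟨by simp [weight, hp, hq, hp', hq'], ?_⟩
    have hin : Conn K (rep (val p) ++ rep (val q)) (rep (val p') ++ rep (val q')) := by
      refine hK _ _ ?_ ?_ (by simpa using hval)
      · simp only [List.length_append]; omega
      · simp only [List.length_append]; omega
    have hA := length_reps_le C (A.map val)
    have hB := length_reps_le C (B.map val)
    have := hin.append (reps (A.map val)) (reps (B.map val))
      (m := weight C ((A ++ p :: q :: B).map val) + K) (by
        simp only [weight, List.map_append, List.map_cons, List.sum_append, List.sum_cons]
          at hA hB ⊢
        omega)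
    simpa [reps] using this

theorem conn_reps [Finite (IdemE S)] {C K n : ℕ}
    (hC : ∀ x ∈ lowClass S, (rep x).length ≤ C)
    (hK : ∀ l l' : List (IdemE S), l.length ≤ 2 * C → l'.length ≤ 2 * C → val l = val l' →
      Conn K l l')
    {l l' : List (IdemE S)} (h : Conn n l l') {Ps : List (List (IdemE S))} (hf : IsFact l Ps)
    (hm : ∀ w Qs, val w = val l → IsFact w Qs → Ps.length ≤ Qs.length) :
    ∃ Qs, IsFact l' Qs ∧ Qs.length = Ps.length ∧
      weight C (Ps.map val) = weight C (Qs.map val) ∧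
        Conn (weight C (Ps.map val) + K) (reps (Ps.map val)) (reps (Qs.map val)) := by
  induction h with
  | refl => exact ⟨Ps, hf, rfl, rfl, .refl⟩
  | @tail b c hb hbc ih =>
    obtain ⟨Qs, hQ, hlen, hw, hc⟩ := ih
    have hvb : val b = val l := (Conn.val_eq hb).symm
    rcases hbc.1 with hs | hs
    · have hvc : val c = val l := hs.val_eq.symm.trans hvb
      obtain ⟨Qs', hQ', hlt | ⟨hlen', hcase⟩⟩ := hQ.contract hs
      · have := hm _ _ hvc hQ'
        omega
      refine ⟨Qs', hQ', hlen'.trans hlen, ?_⟩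
      rcases hcase with h | h | h
      · rw [h]
        exact ⟨hw, hc⟩
      · rcases hQ.move_cases hC hK hQ' h with ⟨⟨Rs, hR, hlt⟩, -⟩ | ⟨h₁, h₂⟩
        · have := hm _ _ hvb hR
          omega
        · exact ⟨hw.trans h₁, hc.trans (hw ▸ h₂)⟩
      · rcases hQ'.move_cases hC hK hQ h with ⟨-, Rs, hR, hlt⟩ | ⟨h₁, h₂⟩
        · have := hm _ _ hvb hR
          omega
        · exact ⟨hw.trans h₁.symm, hc.trans (by rw [hw, ← h₁]; exact h₂.symm)⟩
    · obtain ⟨Qs', hQ', h⟩ := hQ.expand hs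
      refine ⟨Qs', hQ', ?_, h ▸ hw, h ▸ hc⟩
      simpa [hlen] using congrArg List.length h

theorem IsFact.conn_reps {C K : ℕ}
    (hP : ∀ P : List (IdemE S), Seeded P → Conn (P.length + K) P (rep (val P)))
    {l : List (IdemE S)} {Ps : List (List (IdemE S))} (hf : IsFact l Ps) :
    Conn (l.length + weight C (Ps.map val) + K) l (reps (Ps.map val)) := by
  obtain ⟨rfl, hf⟩ := hf
  induction Ps with
  | nil => exact .refl
  | cons P Ps ih =>
    have ih := ih fun Q hQ => hf Q (List.mem_cons_of_mem _ hQ)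
    have hP := hP P (hf P List.mem_cons_self)
    have hl : (rep (val P)).length ≤ max (rep (val P)).length C := le_max_left ..
    have h₁ := hP.append [] Ps.flatten
      (m := (P :: Ps).flatten.length + weight C ((P :: Ps).map val) + K) (by
        simp only [List.flatten_cons, List.length_append, List.length_nil]
        omega)
    have h₂ := ih.append (rep (val P)) []
      (m := (P :: Ps).flatten.length + weight C ((P :: Ps).map val) + K) (by
        simp only [List.flatten_cons, List.length_append, List.length_nil, weight, List.map_cons,
          List.sum_cons]
        omega)
    simpa [reps] using Conn.trans (by simpa using h₁) (by simpa [reps] using h₂)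

theorem exists_minimal_isFact (l : List (IdemE S)) : ∃ Ps, IsFact l Ps ∧
    ∀ w Qs, val w = val l → IsFact w Qs → Ps.length ≤ Qs.length := by
  obtain ⟨Ps, hf, hmin⟩ := WellFounded.has_min
    (measure (List.length : List (List (IdemE S)) → ℕ)).wf {Ps | IsFact l Ps}
    ⟨_, isFact_singletons l⟩
  refine ⟨Ps, hf, fun w Qs hw hQ => ?_⟩
  obtain ⟨Rs, hR, hle⟩ := (exists_isFact_of_eqvGen (val_eq_iff.1 hw)).1 Qs hQ
  exact (not_lt.1 (hmin Rs hR)).trans hle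

theorem exists_conn_linear [Finite (IdemE S)] (hN : (lowClass S).Finite) :
    ∃ C, ∀ l l' : List (IdemE S), val l = val l' →
      Conn (C * (l.length + l'.length + 1)) l l' := by
  obtain ⟨C, K, hC, hlow, hK⟩ := exists_low_bounds hN
  have hP : ∀ P : List (IdemE S), Seeded P → Conn (P.length + K) P (rep (val P)) := by
    intro P hP
    by_cases ht : IsTop (val P)
    · have := length_rep_le P
      exact (conn_of_isTop (val_rep (val P)).symm ht).mono (by omega)
    · exact hlow P hP ⟨⟨P, hP, rfl⟩, ht⟩
  refine ⟨C + K + 2, fun l l' h => ?_⟩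
  obtain ⟨Ps, hf, hmin⟩ := exists_minimal_isFact l
  obtain ⟨n, hn⟩ := exists_conn_of_val_eq h
  obtain ⟨Qs, hQ, -, hw, hc⟩ := conn_reps hC hK hn hf hmin
  have h₁ : Conn _ l _ := hf.conn_reps (C := C) hP
  have h₂ := hQ.conn_reps (C := C) hP
  have hle : weight C (Ps.map val) ≤ l.length + C * l.length := by
    refine (weight_le C Ps).trans ?_
    rw [hf.1]
    exact Nat.add_le_add_left (Nat.mul_le_mul_left _ hf.length_le) _
  have e : (C + K + 2) * (l.length + l'.length + 1) = C * l.length + C * l'.length + C +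
    K * (l.length + l'.length) + K + 2 * (l.length + l'.length) + 2 := by ring
  refine (h₁.mono ?_).trans ((hc.mono ?_).trans (h₂.mono ?_).symm)
  all_goals omega

section Search

variable {α : Type*}

/-- Replacement of two adjacent letters by one, according to `r`. -/
def Contraction (r : α → α → α → Prop) (l l' : List α) : Prop :=
  ∃ (a b : List α) (x y z : α), r x y z ∧ l = a ++ x :: y :: b ∧ l' = a ++ z :: b

/-- A contraction or the inverse of one. -/
def Adjacent (r : α → α → α → Prop) (l l' : List α) : Prop :=
  Contraction r l l' ∨ Contraction r l' l

/-- All words obtained from a word by one contraction or inverse contraction. -/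
def neighbors (ex : α → List (α × α)) (ct : α × α → List α) (l : List α) : List (List α) :=
  List.recOn l [] fun x t ih =>
    ((ex x).map fun p => p.1 :: p.2 :: t) ++
      (List.casesOn t [] fun y s => (ct (x, y)).map fun z => z :: s) ++ ih.map (List.cons x)

theorem mem_neighbors {r : α → α → α → Prop} {ex : α → List (α × α)} {ct : α × α → List α}
    (hex : ∀ x p, p ∈ ex x ↔ r p.1 p.2 x) (hct : ∀ p z, z ∈ ct p ↔ r p.1 p.2 z)
    {l l' : List α} : l' ∈ neighbors ex ct l ↔ Adjacent r l l' := by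
  have cons : ∀ (x : α) (l l' : List α), Contraction r l l' → Contraction r (x :: l) (x :: l') := by
    rintro x _ _ ⟨a, b, u, v, w, h, rfl, rfl⟩
    exact ⟨x :: a, b, u, v, w, h, rfl, rfl⟩
  induction l generalizing l' with
  | nil =>
    simp only [neighbors, List.not_mem_nil, false_iff]
    rintro (⟨a, b, x, y, z, -, h, -⟩ | ⟨a, b, x, y, z, -, -, h⟩) <;> simp at h
  | cons x t ih =>
    have hrec : neighbors ex ct (x :: t) = ((ex x).map fun p => p.1 :: p.2 :: t) ++
      (List.casesOn t [] fun y s => (ct (x, y)).map fun z => z :: s) ++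
        (neighbors ex ct t).map (List.cons x) := rfl
    rw [hrec, List.mem_append, List.mem_append, List.mem_map, List.mem_map]
    constructor
    · rintro ((⟨p, hp, rfl⟩ | h) | ⟨s, hs, rfl⟩)
      · exact Or.inr ⟨[], t, p.1, p.2, x, (hex _ _).1 hp, rfl, rfl⟩
      · cases t with
        | nil => simp at h
        | cons y s =>
          obtain ⟨z, hz, rfl⟩ := List.mem_map.1 h
          exact Or.inl ⟨[], s, x, y, z, (hct _ _).1 hz, rfl, rfl⟩
      · exact (ih.1 hs).imp (cons x _ _) (cons x _ _)
    · rintro (⟨a, b, u, v, w, h, hl, rfl⟩ | ⟨a, b, u, v, w, h, rfl, hl⟩)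
      · cases a with
        | nil =>
          obtain ⟨rfl, rfl⟩ : x = u ∧ t = v :: b := by simpa using hl
          exact Or.inl (Or.inr (List.mem_map.2 ⟨w, (hct _ _).2 h, rfl⟩))
        | cons c a =>
          obtain ⟨rfl, rfl⟩ : x = c ∧ t = a ++ u :: v :: b := by simpa using hl
          exact Or.inr ⟨_, ih.2 (Or.inl ⟨a, b, u, v, w, h, rfl, rfl⟩), rfl⟩
      · cases a with
        | nil =>
          obtain ⟨rfl, rfl⟩ : x = w ∧ t = b := by simpa using hl
          exact Or.inl (Or.inl ⟨(u, v), (hex _ _).2 h, rfl⟩)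
        | cons c a =>
          obtain ⟨rfl, rfl⟩ : x = c ∧ t = a ++ w :: b := by simpa using hl
          exact Or.inr ⟨_, ih.2 (Or.inr ⟨a, b, u, v, w, h, rfl, rfl⟩), rfl⟩

/-- The words reached from `L` in at most one step. -/
def grow (ex : α → List (α × α)) (ct : α × α → List α) (L : List (List α)) : List (List α) :=
  L ++ L.flatMap (neighbors ex ct)

theorem reflTransGen_of_mem_iterate_grow {r : α → α → α → Prop} {ex : α → List (α × α)}
    {ct : α × α → List α} (hex : ∀ x p, p ∈ ex x ↔ r p.1 p.2 x)
    (hct : ∀ p z, z ∈ ct p ↔ r p.1 p.2 z) {l l' : List α} {n : ℕ}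
    (h : l' ∈ (grow ex ct)^[n] [l]) : Relation.ReflTransGen (Adjacent r) l l' := by
  induction n generalizing l' with
  | zero =>
    obtain rfl : l' = l := by simpa using h
    exact .refl
  | succ n ih =>
    rw [Function.iterate_succ_apply', grow, List.mem_append, List.mem_flatMap] at h
    rcases h with h | ⟨m, hm, h⟩
    · exact ih h
    · exact (ih hm).tail ((mem_neighbors hex hct).1 h)

theorem mem_iterate_grow_of_le {ex : α → List (α × α)} {ct : α × α → List α} {L : List (List α)}
    {l : List α} {m n : ℕ} (hmn : m ≤ n) (h : l ∈ (grow ex ct)^[m] L) :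
    l ∈ (grow ex ct)^[n] L := by
  induction n, hmn using Nat.le_induction with
  | base => exact h
  | succ n _ ih =>
    rw [Function.iterate_succ_apply']
    exact List.mem_append_left _ ih

theorem card_short_words_le [Fintype α] (n : ℕ) : Finite {l : List α // l.length ≤ n} ∧
    Nat.card {l : List α // l.length ≤ n} ≤ (Fintype.card α + 1) ^ n := by
  let f : {l : List α // l.length ≤ n} → Fin n → Option α := fun l i => l.1[(i : ℕ)]?
  have hf : Function.Injective f := by
    refine fun l l' h => Subtype.ext (List.ext_getElem? fun i => ?_)
    by_cases hi : i < n
    · exact congrFun h ⟨i, hi⟩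
    · rw [List.getElem?_eq_none (l.2.trans (not_lt.1 hi)),
        List.getElem?_eq_none (l'.2.trans (not_lt.1 hi))]
  refine ⟨.of_injective f hf, (Nat.card_le_card_of_injective f hf).trans ?_⟩
  simp

theorem mem_iterate_grow [Fintype α] {r : α → α → α → Prop} {ex : α → List (α × α)}
    {ct : α × α → List α} (hex : ∀ x p, p ∈ ex x ↔ r p.1 p.2 x)
    (hct : ∀ p z, z ∈ ct p ↔ r p.1 p.2 z) {l l' : List α} {n : ℕ}
    (h : Relation.ReflTransGen
      (fun a b => Adjacent r a b ∧ a.length ≤ n ∧ b.length ≤ n) l l') :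
    l' ∈ (grow ex ct)^[(Fintype.card α + 1) ^ n] [l] := by
  rcases h.cases_head with rfl | ⟨-, ⟨-, hl, -⟩, -⟩
  · exact mem_iterate_grow_of_le (Nat.zero_le _) (by simp)
  obtain ⟨hfin, hcard⟩ := card_short_words_le (α := α) n
  have := Fintype.ofFinite {l : List α // l.length ≤ n}
  let G : SimpleGraph {l : List α // l.length ≤ n} :=
    SimpleGraph.fromRel fun a b => Adjacent r a.1 b.1
  have hG : ∀ a b, G.Adj a b → Adjacent r a.1 b.1 := fun a b h => h.2.elim id Or.symm
  have reach : ∃ hl' : l'.length ≤ n, G.Reachable ⟨l, hl⟩ ⟨l', hl'⟩ := by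
    induction h with
    | refl => exact ⟨_, .refl _⟩
    | @tail b c _ hbc ih =>
      obtain ⟨hb, ih⟩ := ih
      refine ⟨hbc.2.2, ih.trans ?_⟩
      by_cases e : b = c
      · subst e; rfl
      · exact SimpleGraph.Adj.reachable ⟨fun h => e (congrArg Subtype.val h), Or.inl hbc.1⟩
  obtain ⟨hl', hreach⟩ := reach
  obtain ⟨p, hp⟩ := hreach.exists_isPath
  have walk : ∀ {a b : {l : List α // l.length ≤ n}} (p : G.Walk a b),
      b.1 ∈ (grow ex ct)^[p.length] [a.1] := by
    intro a b p
    induction p using SimpleGraph.Walk.concatRec with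
    | Hnil => simp
    | Hconcat p h ih =>
      rw [SimpleGraph.Walk.length_concat, Function.iterate_succ_apply']
      exact List.mem_append_right _ (List.mem_flatMap.2
        ⟨_, ih, (mem_neighbors hex hct).2 (hG _ _ h)⟩)
  refine mem_iterate_grow_of_le ?_ (walk p)
  rw [Nat.card_eq_fintype_card] at hcard
  exact hp.length_lt.le.trans hcard

theorem primrec_neighbors [Primcodable α] [Finite α] (ex : α → List (α × α))
    (ct : α × α → List α) : Primrec (neighbors ex ct) := by
  have hex : Primrec ex := .dom_finite ex
  have hct : Primrec ct := .dom_finite ct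
  refine Primrec.list_rec (h := fun _ q =>
    ((ex q.1).map fun p => p.1 :: p.2 :: q.2.1) ++
      (List.casesOn q.2.1 [] fun y s => (ct (q.1, y)).map fun z => z :: s) ++
        q.2.2.map (List.cons q.1)) .id (.const []) ?_
  have h1 : Primrec fun q : List α × α × List α × List (List α) => q.2.1 :=
    Primrec.fst.comp .snd
  have h2 : Primrec fun q : List α × α × List α × List (List α) => q.2.2.1 :=
    Primrec.fst.comp (Primrec.snd.comp .snd)
  have h3 : Primrec fun q : List α × α × List α × List (List α) => q.2.2.2 :=
    Primrec.snd.comp (Primrec.snd.comp .snd)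
  refine Primrec.list_append.comp (Primrec.list_append.comp ?_ ?_) ?_
  · refine Primrec.list_map (hex.comp h1) ?_
    exact Primrec.list_cons.comp (Primrec.fst.comp .snd)
      (Primrec.list_cons.comp (Primrec.snd.comp .snd) (h2.comp .fst))
  · refine Primrec.list_casesOn (h := fun q p => (ct (q.2.1, p.1)).map fun z => z :: p.2)
      h2 (.const []) ?_
    refine Primrec.list_map (hct.comp (.pair (h1.comp .fst) (Primrec.fst.comp .snd))) ?_
    exact Primrec.list_cons.comp .snd (Primrec.snd.comp (Primrec.snd.comp .fst))
  · refine Primrec.list_map h3 ?_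
    exact Primrec.list_cons.comp (h1.comp .fst) .snd

theorem primrecPred_reflTransGen [Primcodable α] [Finite α] (r : α → α → α → Prop) (C : ℕ)
    (hC : ∀ l l' : List α, Relation.ReflTransGen (Adjacent r) l l' →
      Relation.ReflTransGen (fun a b => Adjacent r a b ∧
        a.length ≤ C * (l.length + l'.length + 1) ∧ b.length ≤ C * (l.length + l'.length + 1))
        l l') :
    PrimrecPred fun p : List α × List α => Relation.ReflTransGen (Adjacent r) p.1 p.2 := by
  classical
  have := Fintype.ofFinite α
  let ex : α → List (α × α) := fun x => (Finset.univ.filter fun p => r p.1 p.2 x).toList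
  let ct : α × α → List α := fun p => (Finset.univ.filter fun z => r p.1 p.2 z).toList
  have hex : ∀ x p, p ∈ ex x ↔ r p.1 p.2 x := by simp [ex]
  have hct : ∀ p z, z ∈ ct p ↔ r p.1 p.2 z := by simp [ct]
  have hgrow : Primrec (grow ex ct) :=
    Primrec.list_append.comp .id
      (Primrec.list_flatMap .id ((primrec_neighbors ex ct).comp .snd))
  let N : List α × List α → ℕ := fun p => C * (p.1.length + p.2.length + 1)
  have hN : Primrec N := by
    refine Primrec.nat_mul.comp (.const C) (Primrec.succ.comp (Primrec.nat_add.comp ?_ ?_))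
    · exact Primrec.list_length.comp .fst
    · exact Primrec.list_length.comp .snd
  have hpow : Primrec fun p => (Fintype.card α + 1) ^ N p := by
    have : Primrec fun p => (fun m => (Fintype.card α + 1) * m)^[N p] 1 :=
      Primrec.nat_iterate hN (.const 1) (Primrec.nat_mul.comp (.const _) .snd)
    refine this.of_eq fun p => ?_
    simp only [mul_left_iterate, mul_one]
  have hiter : Primrec fun p : List α × List α =>
      (grow ex ct)^[(Fintype.card α + 1) ^ N p] [p.1] :=
    Primrec.nat_iterate hpow (Primrec.list_cons.comp .fst (.const [])) (hgrow.comp .snd)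
  have hmem := (PrimrecRel.exists_mem_list (R := fun a b : List α => a = b) Primrec.eq).comp hiter
    Primrec.snd
  refine hmem.of_eq fun p => ⟨?_, fun h => ⟨_, mem_iterate_grow hex hct (hC _ _ h), rfl⟩⟩
  rintro ⟨a, ha, rfl⟩
  exact reflTransGen_of_mem_iterate_grow hex hct ha

end Search

section Encoding

variable {k : ℕ} (ι : IdemE S ≃ Fin k)

/-- The defining relations of `IG(E)` on encoded letters. -/
def codeRel (x y z : Fin k) : Prop :=
  BasicPair (ι.symm x) (ι.symm y) ∧ ((ι.symm z : IdemE S) : S) = ι.symm x * ι.symm y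

theorem Step.contraction {l l' : List (IdemE S)} (h : Step l l') :
    Contraction (codeRel ι) (l.map ι) (l'.map ι) := by
  obtain ⟨a, b, x, y, z, hb, hz, rfl, rfl⟩ := h
  exact ⟨a.map ι, b.map ι, ι x, ι y, ι z, by simpa [codeRel] using ⟨hb, hz⟩, by simp, by simp⟩

theorem Contraction.step {l l' : List (Fin k)} (h : Contraction (codeRel ι) l l') :
    Step (l.map ι.symm) (l'.map ι.symm) := by
  obtain ⟨a, b, x, y, z, ⟨hb, hz⟩, rfl, rfl⟩ := h
  exact ⟨a.map ι.symm, b.map ι.symm, ι.symm x, ι.symm y, ι.symm z, hb, hz, by simp, by simp⟩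

theorem reflTransGen_adjacent_of_conn {l l' : List (Fin k)} {n : ℕ}
    (h : Conn n (l.map ι.symm) (l'.map ι.symm)) : Relation.ReflTransGen
      (fun a b => Adjacent (codeRel ι) a b ∧ a.length ≤ n ∧ b.length ≤ n) l l' := by
  have := Relation.ReflTransGen.lift (p := fun a b => Adjacent (codeRel ι) a b ∧
    a.length ≤ n ∧ b.length ≤ n) (List.map ι) (fun a b hab =>
      ⟨hab.1.imp (fun h => h.contraction ι) (fun h => h.contraction ι), by simpa using hab.2⟩) _ _ h
  simpa [Function.onFun] using this

theorem val_eq_of_reflTransGen_adjacent {l l' : List (Fin k)}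
    (h : Relation.ReflTransGen (Adjacent (codeRel ι)) l l') :
    val (l.map ι.symm) = val (l'.map ι.symm) := by
  induction h with
  | refl => rfl
  | tail _ h ih =>
    exact ih.trans (h.elim (fun h => (h.step ι).val_eq) fun h => (h.step ι).val_eq.symm)

theorem exists_encodeWord_iff (l l' : List (Fin k)) :
    (∃ u v : FreeSemigroup (IdemE S), encodeWord ι u = l ∧ encodeWord ι v = l' ∧
      igBar u = igBar v) ↔ l ≠ [] ∧ l' ≠ [] ∧ val (l.map ι.symm) = val (l'.map ι.symm) := by
  constructor
  · rintro ⟨u, v, rfl, rfl, h⟩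
    refine ⟨by simp [encodeWord, wordList], by simp [encodeWord, wordList], ?_⟩
    simpa [encodeWord, val_wordList] using h
  · rintro ⟨h, h', he⟩
    obtain ⟨u, hu⟩ := exists_wordList (l := l.map ι.symm) (by simpa using h)
    obtain ⟨v, hv⟩ := exists_wordList (l := l'.map ι.symm) (by simpa using h')
    refine ⟨u, v, by simp [encodeWord, hu], by simp [encodeWord, hv], ?_⟩
    rwa [← hu, ← hv, val_wordList, val_wordList, WithOne.coe_inj] at he

theorem primrecPred_val_eq [Finite (IdemE S)] (hN : (lowClass S).Finite) :
    PrimrecPred fun p : List (Fin k) × List (Fin k) =>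
      val (p.1.map ι.symm) = val (p.2.map ι.symm) := by
  obtain ⟨C, hC⟩ := exists_conn_linear hN
  have hconn : ∀ l l' : List (Fin k), val (l.map ι.symm) = val (l'.map ι.symm) →
      Relation.ReflTransGen (fun a b => Adjacent (codeRel ι) a b ∧
        a.length ≤ C * (l.length + l'.length + 1) ∧ b.length ≤ C * (l.length + l'.length + 1))
        l l' := fun l l' h =>
    reflTransGen_adjacent_of_conn ι (by simpa using hC _ _ h)
  refine (primrecPred_reflTransGen (codeRel ι) C fun l l' h => hconn l l'
    (val_eq_of_reflTransGen_adjacent ι h)).of_eq fun p =>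
      ⟨val_eq_of_reflTransGen_adjacent ι, fun h => ?_⟩
  exact Relation.ReflTransGen.mono (fun _ _ h => h.1) _ _ (hconn _ _ h)

end Encoding

end IGWord

theorem stmt12 {S : Type*} [Semigroup S] [Finite (IdemE S)]
    -- the maximal subgroup of every non-maximal regular 𝓓-class is finite
    (hfin : ∀ ε : IG S, ε * ε = ε → ¬ IsMaxRegDClass ε →
      Set.Finite {x : IG S | GreenR ε x ∧ GreenL ε x})
    (k : ℕ) (ι : IdemE S ≃ Fin k) :
    -- the word problem of IG(E) is decidable
    ComputablePred (fun ab : List (Fin k) × List (Fin k) =>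
      ∃ u v : FreeSemigroup (IdemE S),
        encodeWord ι u = ab.1 ∧ encodeWord ι v = ab.2 ∧ igBar u = igBar v) := by
  have hN := IGWord.finite_lowClass fun e he => IGWord.finite_hClass hfin he
  have h : PrimrecPred fun ab : List (Fin k) × List (Fin k) => ab.1 ≠ [] ∧ ab.2 ≠ [] ∧
      IGWord.val (ab.1.map ι.symm) = IGWord.val (ab.2.map ι.symm) :=
    (PrimrecPred.not (Primrec.eq.comp .fst (.const []))).and
      ((PrimrecPred.not (Primrec.eq.comp .snd (.const []))).and
        (IGWord.primrecPred_val_eq ι hN))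
  exact h.computablePred.of_eq fun ab => (IGWord.exists_encodeWord_iff ι ab.1 ab.2).symm
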